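/- arXiv:2404.10391 — 7 statements merged into one kernel-verified Lean document; each statement's English description precedes it below -/
import Mathlib

section
/- Consider the semidiscrete SD-RT(1) scheme on the right-triangular mesh for the transport equation with transport velocity ω = (ω_x, ω_y) satisfying ω_x > 0 and ω_y > 0. Then the optimal order of accuracy of the scheme is 2: the scheme has order 2, but it does not have order 3. -/
open Matrix

noncomputable section

/-- Coefficient matrix `L^x_{(0,0)}` of the SD-RT(1) scheme. -/
def Lx00 : Matrix (Fin 6) (Fin 6) ℝ :=
  !![3,1,1,0,0,0; -3,1,-2,0,0,0; 0,1,4,0,0,0;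
     0,-1,-4,3,1,1; 0,2,2,-3,1,-2; 0,-4,-1,0,1,4]

/-- Coefficient matrix `L^x_{(-1,0)}` of the SD-RT(1) scheme. -/
def Lxm : Matrix (Fin 6) (Fin 6) ℝ :=
  !![0,0,0,0,-1,-4; 0,0,0,0,2,2; 0,0,0,0,-4,-1;
     0,0,0,0,0,0; 0,0,0,0,0,0; 0,0,0,0,0,0]

/-- Coefficient matrix `L^y_{(0,0)}` of the SD-RT(1) scheme. -/
def Ly00 : Matrix (Fin 6) (Fin 6) ℝ :=
  !![3,1,1,0,0,0; 0,4,1,0,0,0; -3,-2,1,0,0,0;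
     0,-1,-4,4,1,0; 0,2,2,-2,1,-3; 0,-4,-1,1,1,3]

/-- Coefficient matrix `L^y_{(0,-1)}` of the SD-RT(1) scheme. -/
def Lym : Matrix (Fin 6) (Fin 6) ℝ :=
  !![0,0,0,-4,-1,0; 0,0,0,-1,-4,0; 0,0,0,2,2,0;
     0,0,0,0,0,0; 0,0,0,0,0,0; 0,0,0,0,0,0]

/-- `L_{(0,0)} = ω_x · Lx00 + ω_y · Ly00`. -/
def L00 (ω : ℝ × ℝ) : Matrix (Fin 6) (Fin 6) ℝ := ω.1 • Lx00 + ω.2 • Ly00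

/-- `L_{(-1,0)} = ω_x · Lxm`. -/
def Lm0 (ω : ℝ × ℝ) : Matrix (Fin 6) (Fin 6) ℝ := ω.1 • Lxm

/-- `L_{(0,-1)} = ω_y · Lym`. -/
def L0m (ω : ℝ × ℝ) : Matrix (Fin 6) (Fin 6) ℝ := ω.2 • Lym

/-- `L(0) = L_{(0,0)} + L_{(-1,0)} + L_{(0,-1)}`. -/
def Lzero (ω : ℝ × ℝ) : Matrix (Fin 6) (Fin 6) ℝ := L00 ω + Lm0 ω + L0m ω

/-- Solution points `a_1,…,a_6` of the reference block. -/
def apt : Fin 6 → ℝ × ℝ := ![(0,0), (1,0), (0,1), (0,1), (1,1), (1,0)]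

/-- A mesh function on the periodic mesh with `N × N` blocks. -/
abbrev Mesh (N : ℕ) := (ZMod N × ZMod N) → (Fin 6 → ℝ)

/-- The norm `‖u‖² = Σ_η h² |u_η|²` with `h = 1/N` (Euclidean norm on `ℝ^6`). -/
def meshNorm (N : ℕ) [NeZero N] (u : Mesh N) : ℝ :=
  Real.sqrt (∑ η : ZMod N × ZMod N, ((1 : ℝ) / N) ^ 2 * ∑ ξ : Fin 6, (u η ξ) ^ 2)

/-- The Lagrangian mapping `Π_h`, `h = 1/N`: `(Π_h v)_{η,ξ} = v((η + a_ξ)h)`. -/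
def Pih (N : ℕ) [NeZero N] (v : ℝ × ℝ → ℝ) : Mesh N :=
  fun η ξ => v ((((η.1.val : ℝ) + (apt ξ).1) / N, ((η.2.val : ℝ) + (apt ξ).2) / N))

/-- 1-periodicity in both variables. -/
def Periodic2 (v : ℝ × ℝ → ℝ) : Prop :=
  (∀ x y : ℝ, v (x + 1, y) = v (x, y)) ∧ (∀ x y : ℝ, v (x, y + 1) = v (x, y))

/-- `u : ℝ → Mesh N` solves the semidiscrete SD-RT(1) scheme
`du_η/dt + (1/h) Σ_{ζ∈S} L_ζ u_{η+ζ} = 0`, `h = 1/N`. -/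
def IsSol (ω : ℝ × ℝ) (N : ℕ) [NeZero N] (u : ℝ → Mesh N) : Prop :=
  ∀ (η : ZMod N × ZMod N) (t : ℝ),
    HasDerivAt (fun s => u s η)
      (-((N : ℝ) • (L00 ω *ᵥ u t η + Lm0 ω *ᵥ u t (η + (-1, 0))
          + L0m ω *ᵥ u t (η + (0, -1))))) t

/-- The scheme has order `q`: for every 1-periodic `v0 ∈ C^{q+1}` the solution error
satisfies `‖ε_h(t,v0)‖ ≤ (c1 + c2 t) h^q` for all `N` and `t ≥ 0`. -/
def HasOrder (ω : ℝ × ℝ) (q : ℕ) : Prop :=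
  ∀ v0 : ℝ × ℝ → ℝ, Periodic2 v0 → ContDiff ℝ (q + 1 : ℕ) v0 →
    ∃ c1 c2 : ℝ, 0 ≤ c1 ∧ 0 ≤ c2 ∧
      ∀ (N : ℕ) [NeZero N], ∀ u : ℝ → Mesh N, IsSol ω N u → u 0 = Pih N v0 →
        ∀ t : ℝ, 0 ≤ t →
          meshNorm N (u t - Pih N (fun r => v0 (r - t • ω)))
            ≤ (c1 + c2 * t) * ((1 : ℝ) / N) ^ q

section Taylor

variable {E F : Type*} [NormedAddCommGroup E] [NormedSpace ℝ E]
  [NormedAddCommGroup F] [NormedSpace ℝ F]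

/-- A function vanishing at `p` whose derivative is `O(‖x - p‖ ^ n)` is `O(‖x - p‖ ^ (n + 1))`. -/
lemma norm_le_of_norm_fderiv_le_pow {f : E → F} {f' : E → E →L[ℝ] F} {p : E} {K : ℝ} (n : ℕ)
    (hK : 0 ≤ K) (hf : ∀ x, HasFDerivAt f (f' x) x) (h0 : f p = 0)
    (hb : ∀ x, ‖f' x‖ ≤ K * ‖x - p‖ ^ n) (x : E) : ‖f x‖ ≤ K * ‖x - p‖ ^ (n + 1) := by
  have hconv : Convex ℝ (Metric.closedBall p ‖x - p‖) := convex_closedBall _ _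
  have := hconv.norm_image_sub_le_of_norm_hasFDerivWithin_le (f := f) (f' := f')
    (C := K * ‖x - p‖ ^ n) (x := p) (y := x)
    (fun y _ => (hf y).hasFDerivWithinAt)
    (fun y hy => (hb y).trans (by
      have : ‖y - p‖ ≤ ‖x - p‖ := by simpa [dist_eq_norm] using hy
      gcongr))
    (by simp) (by simp [dist_eq_norm])
  rw [h0, sub_zero] at this
  rw [pow_succ, ← mul_assoc]
  exact this

variable {v : E → ℝ}

/-- First-order Taylor estimate for a `C²` function with bounded second derivative. -/
lemma taylor_estimate_one (hv : ContDiff ℝ 2 v) {K : ℝ} (hK : 0 ≤ K)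
    (hb : ∀ x, ‖fderiv ℝ (fderiv ℝ v) x‖ ≤ K) (p x : E) :
    |v x - v p - fderiv ℝ v p (x - p)| ≤ K * ‖x - p‖ ^ 2 := by
  have h1 : ContDiff ℝ 1 (fderiv ℝ v) := hv.fderiv_right (by norm_num)
  have d0 : ∀ x, HasFDerivAt v (fderiv ℝ v x) x := fun x =>
    (hv.differentiable (by norm_num) x).hasFDerivAt
  have d1 : ∀ x, HasFDerivAt (fderiv ℝ v) (fderiv ℝ (fderiv ℝ v) x) x := fun x =>
    (h1.differentiable (by norm_num) x).hasFDerivAt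
  have b1 : ∀ x, ‖fderiv ℝ v x - fderiv ℝ v p‖ ≤ K * ‖x - p‖ ^ 1 :=
    norm_le_of_norm_fderiv_le_pow 0 hK (fun x => (d1 x).sub_const _) (by simp)
      (fun x => by simpa using hb x)
  have := norm_le_of_norm_fderiv_le_pow 1 hK
      (fun x => ((d0 x).sub_const (v p)).sub
        ((fderiv ℝ v p).hasFDerivAt.comp x ((hasFDerivAt_id x).sub_const p)))
      (p := p) (by simp) (fun x => by simpa using b1 x) x
  simpa using this

set_option maxSynthPendingDepth 6 in
/-- Taylor estimates for a `C³` function with bounded third derivative. -/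
lemma taylor_estimates (hv : ContDiff ℝ 3 v) {K : ℝ} (hK : 0 ≤ K)
    (hb : ∀ x, ‖fderiv ℝ (fderiv ℝ (fderiv ℝ v)) x‖ ≤ K) (p x : E) :
    ‖fderiv ℝ v x - fderiv ℝ v p - fderiv ℝ (fderiv ℝ v) p (x - p)‖ ≤ K * ‖x - p‖ ^ 2 ∧
    |v x - v p - fderiv ℝ v p (x - p) - fderiv ℝ (fderiv ℝ v) p (x - p) (x - p) / 2|
      ≤ K * ‖x - p‖ ^ 3 := by
  have h1 : ContDiff ℝ 2 (fderiv ℝ v) := hv.fderiv_right (by norm_num)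
  have h2 : ContDiff ℝ 1 (fderiv ℝ (fderiv ℝ v)) := h1.fderiv_right (by norm_num)
  have d0 : ∀ x, HasFDerivAt v (fderiv ℝ v x) x := fun x =>
    (hv.differentiable (by norm_num) x).hasFDerivAt
  have d1 : ∀ x, HasFDerivAt (fderiv ℝ v) (fderiv ℝ (fderiv ℝ v) x) x := fun x =>
    (h1.differentiable (by norm_num) x).hasFDerivAt
  have d2 : ∀ x, HasFDerivAt (fderiv ℝ (fderiv ℝ v)) (fderiv ℝ (fderiv ℝ (fderiv ℝ v)) x) x :=
    fun x => (h2.differentiable (by norm_num) x).hasFDerivAt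
  have b2 : ∀ x, ‖fderiv ℝ (fderiv ℝ v) x - fderiv ℝ (fderiv ℝ v) p‖ ≤ K * ‖x - p‖ ^ 1 :=
    norm_le_of_norm_fderiv_le_pow 0 hK (fun x => (d2 x).sub_const _) (by simp)
      (fun x => by simpa using hb x)
  have b1 : ∀ x, ‖fderiv ℝ v x - fderiv ℝ v p - fderiv ℝ (fderiv ℝ v) p (x - p)‖
      ≤ K * ‖x - p‖ ^ 2 :=
    norm_le_of_norm_fderiv_le_pow 1 hK
      (fun x => ((d1 x).sub_const _).sub
        ((fderiv ℝ (fderiv ℝ v) p).hasFDerivAt.comp x ((hasFDerivAt_id x).sub_const p)))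
      (by simp) (fun x => by simpa using b2 x)
  refine ⟨b1 x, ?_⟩
  have hsymm : ∀ a b, fderiv ℝ (fderiv ℝ v) p a b = fderiv ℝ (fderiv ℝ v) p b a :=
    second_derivative_symmetric d0 (d1 p)
  have hquad : ∀ x, HasFDerivAt
      (fun x => fderiv ℝ (fderiv ℝ v) p (x - p) (x - p) / 2)
      (fderiv ℝ (fderiv ℝ v) p (x - p)) x := by
    intro x
    have hid := (hasFDerivAt_id (𝕜 := ℝ) x).sub_const p
    have hl := (fderiv ℝ (fderiv ℝ v) p).hasFDerivAt.comp x hid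
    have := (hl.clm_apply hid).mul_const (2⁻¹ : ℝ)
    simp only [div_eq_mul_inv]
    refine this.congr_fderiv ?_
    ext y
    simp [hsymm y x, hsymm y p]
    ring
  have := norm_le_of_norm_fderiv_le_pow 2 hK
      (fun x => (((d0 x).sub_const (v p)).sub
        ((fderiv ℝ v p).hasFDerivAt.comp x ((hasFDerivAt_id x).sub_const p))).sub (hquad x))
      (p := p) (by simp) (fun x => by simpa using b1 x) x
  simpa using this

end Taylor

/-- A continuous function on the plane that is `1`-periodic in both variables is bounded. -/
lemma exists_norm_le_of_periodic {F : Type*} [NormedAddCommGroup F] {f : ℝ × ℝ → F}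
    (hf : Continuous f) (h1 : ∀ r, f (r + (1, 0)) = f r) (h2 : ∀ r, f (r + (0, 1)) = f r) :
    ∃ K, 0 ≤ K ∧ ∀ r, ‖f r‖ ≤ K := by
  obtain ⟨K, hK⟩ := (isCompact_Icc (a := ((0, 0) : ℝ × ℝ)) (b := (1, 1))).exists_bound_of_continuousOn
    hf.continuousOn
  have p1 : Function.Periodic f (1, 0) := h1
  have p2 : Function.Periodic f (0, 1) := h2
  have key : ∀ r, ‖f r‖ ≤ K := by
    intro r
    have hr : f (Int.fract r.1, Int.fract r.2) = f r := by
      rw [← p1.int_mul ⌊r.1⌋, ← p2.int_mul ⌊r.2⌋]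
      congr 1
      ext <;> simp
    rw [← hr]
    exact hK _ ⟨⟨Int.fract_nonneg _, Int.fract_nonneg _⟩,
      ⟨(Int.fract_lt_one _).le, (Int.fract_lt_one _).le⟩⟩
  exact ⟨K, (norm_nonneg _).trans (key 0), key⟩

lemma fderiv_periodic {E F : Type*} [NormedAddCommGroup E] [NormedSpace ℝ E]
    [NormedAddCommGroup F] [NormedSpace ℝ F] {f : E → F} {a : E} (h : ∀ r, f (r + a) = f r)
    (r : E) : fderiv ℝ f (r + a) = fderiv ℝ f r := by
  rw [← fderiv_comp_add_right]
  congr 1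
  funext x
  exact h x

set_option maxSynthPendingDepth 6 in
/-- Uniform bounds for the second and third derivatives of a periodic `C³` function. -/
lemma exists_bound_fderiv_of_periodic {v : ℝ × ℝ → ℝ} (hp : Periodic2 v) (hv : ContDiff ℝ 3 v) :
    ∃ K, 0 ≤ K ∧ (∀ x, ‖fderiv ℝ (fderiv ℝ v) x‖ ≤ K) ∧
      ∀ x, ‖fderiv ℝ (fderiv ℝ (fderiv ℝ v)) x‖ ≤ K := by
  have h1 : ContDiff ℝ 2 (fderiv ℝ v) := hv.fderiv_right (by norm_num)
  have h2 : ContDiff ℝ 1 (fderiv ℝ (fderiv ℝ v)) := h1.fderiv_right (by norm_num)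
  have h3 : ContDiff ℝ 0 (fderiv ℝ (fderiv ℝ (fderiv ℝ v))) := h2.fderiv_right (by norm_num)
  have p1 : ∀ r, v (r + (1, 0)) = v r := fun r => by
    rw [← hp.1 r.1 r.2]; congr 1; ext <;> simp
  have p2 : ∀ r, v (r + (0, 1)) = v r := fun r => by
    rw [← hp.2 r.1 r.2]; congr 1; ext <;> simp
  obtain ⟨K, hK, hb⟩ := exists_norm_le_of_periodic h2.continuous
    (fderiv_periodic (fderiv_periodic p1)) (fderiv_periodic (fderiv_periodic p2))
  obtain ⟨K', _, hb'⟩ := exists_norm_le_of_periodic h3.continuous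
    (fderiv_periodic (fderiv_periodic (fderiv_periodic p1)))
    (fderiv_periodic (fderiv_periodic (fderiv_periodic p2)))
  exact ⟨max K K', hK.trans (le_max_left _ _), fun x => (hb x).trans (le_max_left _ _),
    fun x => (hb' x).trans (le_max_right _ _)⟩

/-- The inner product of a block in which the scheme is dissipative: on each of the two triangles
it is three times the Euclidean one plus twice the product of the sums. -/
def blockForm (u w : Fin 6 → ℝ) : ℝ :=
  3 * ∑ ξ, u ξ * w ξ + 2 * (u 0 + u 1 + u 2) * (w 0 + w 1 + w 2)
    + 2 * (u 3 + u 4 + u 5) * (w 3 + w 4 + w 5)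

lemma blockForm_dissipation {ω : ℝ × ℝ} (hx : 0 ≤ ω.1) (hy : 0 ≤ ω.2) (u a b : Fin 6 → ℝ) :
    9 * (ω.1 * (u 4 ^ 2 + u 4 * u 5 + u 5 ^ 2) + ω.2 * (u 3 ^ 2 + u 3 * u 4 + u 4 ^ 2))
      - 9 * (ω.1 * (a 4 ^ 2 + a 4 * a 5 + a 5 ^ 2) + ω.2 * (b 3 ^ 2 + b 3 * b 4 + b 4 ^ 2))
      ≤ blockForm u (L00 ω *ᵥ u + Lm0 ω *ᵥ a + L0m ω *ᵥ b) := by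
  have P : ∀ s t : ℝ, 0 ≤ s ^ 2 + s * t + t ^ 2 := fun s t => by
    nlinarith [sq_nonneg (s + t), sq_nonneg s, sq_nonneg t]
  have h1 := mul_nonneg hx (P (u 0 - a 5) (u 2 - a 4))
  have h2 := mul_nonneg hy (P (u 0 - b 3) (u 1 - b 4))
  have h3 := mul_nonneg (add_nonneg hx hy) (P (u 1 - u 5) (u 2 - u 3))
  rw [← sub_nonneg]
  refine (mul_nonneg (by norm_num : (0 : ℝ) ≤ 9) (add_nonneg (add_nonneg h1 h2) h3)).trans_eq ?_
  simp [blockForm, L00, Lm0, L0m, Lx00, Lxm, Ly00, Lym, dotProduct,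
    Fin.sum_univ_six]
  ring
/-- The second-difference correction added to the samples `F` of a function on the lattice. -/
def corrector (c : Fin 3 → Fin 6 → ℝ) (F : ℝ → ℝ → ℝ) (m n : ℝ) (ξ : Fin 6) : ℝ :=
  c 0 ξ * (F (m + 1) n - 2 * F m n + F (m - 1) n)
    + c 1 ξ * (F (m + 1) (n + 1) - F (m + 1) n - F m (n + 1) + F m n)
    + c 2 ξ * (F m (n + 1) - 2 * F m n + F m (n - 1))

/-- The values of `F` at the solution points of the block `(m, n)`, plus the correction. -/
def lift (c : Fin 3 → Fin 6 → ℝ) (F : ℝ → ℝ → ℝ) (m n : ℝ) (ξ : Fin 6) : ℝ :=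
  F (m + (apt ξ).1) (n + (apt ξ).2) + corrector c F m n ξ

/-- The operator `Σ_ζ L_ζ G_ζ` at the origin. -/
def stencil (ω : ℝ × ℝ) (G : ℝ → ℝ → Fin 6 → ℝ) : Fin 6 → ℝ :=
  L00 ω *ᵥ G 0 0 + Lm0 ω *ᵥ G (-1) 0 + L0m ω *ᵥ G 0 (-1)

/-- A quadratic polynomial. -/
def quadr (j a b A B C : ℝ) (m n : ℝ) : ℝ :=
  j + a * m + b * n + (A * m ^ 2 + 2 * B * m * n + C * n ^ 2) / 2

/-- The derivative of `quadr j a b A B C` in the direction `ω`. -/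
def quadrDeriv (ω : ℝ × ℝ) (a b A B C : ℝ) (m n : ℝ) : ℝ :=
  ω.1 * (a + A * m + B * n) + ω.2 * (b + B * m + C * n)

lemma stencil_quadr (ω : ℝ × ℝ) (j a b A B C : ℝ) :
    stencil ω (fun m n ξ => quadr j a b A B C (m + (apt ξ).1) (n + (apt ξ).2))
      = fun ξ => quadrDeriv ω a b A B C (apt ξ).1 (apt ξ).2
        + (A / 2 * (ω.1 * ![1, -1, 1, 1, -1, -1] ξ)
          + B * (ω.1 * ![0, 0, -1, 0, 0, 1] ξ + ω.2 * ![0, -1, 0, 1, 0, 0] ξ)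
          + C / 2 * (ω.2 * ![1, 1, -1, -1, -1, 1] ξ)) := by
  ext ξ
  fin_cases ξ <;>
  · simp [stencil, quadr, quadrDeriv, apt, L00, Lm0, L0m, Lx00, Lxm, Ly00, Lym,
      dotProduct, Fin.sum_univ_six]
    ring

lemma corrector_quadr (c : Fin 3 → Fin 6 → ℝ) (j a b A B C m n : ℝ) (ξ : Fin 6) :
    corrector c (quadr j a b A B C) m n ξ = A * c 0 ξ + B * c 1 ξ + C * c 2 ξ := by
  simp only [corrector, quadr]
  ring

lemma corrector_quadrDeriv (c : Fin 3 → Fin 6 → ℝ) (ω : ℝ × ℝ) (a b A B C m n : ℝ)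
    (ξ : Fin 6) : corrector c (quadrDeriv ω a b A B C) m n ξ = 0 := by
  simp only [corrector, quadrDeriv]
  ring

lemma exists_Lzero_mulVec_xx {ω : ℝ × ℝ} (hx : 0 < ω.1) (hy : 0 < ω.2) :
    ∃ c : Fin 6 → ℝ, Lzero ω *ᵥ c = fun ξ => -(1 / 2 * (ω.1 * ![1, -1, 1, 1, -1, -1] ξ)) := by
  obtain ⟨x, y⟩ := ω
  simp only at hx hy
  have hxy : x + y ≠ 0 := by positivity
  refine ⟨(1 / (108 * y * (x + y))) • ![
    x ^ 2 - 7 * x * y - 11 * y ^ 2, x ^ 2 - 5 * x * y + 11 * y ^ 2,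
    -x ^ 2 + 7 * x * y - 11 * y ^ 2, -x ^ 2 - 17 * x * y - 11 * y ^ 2,
    -x ^ 2 + 15 * x * y + 11 * y ^ 2, x ^ 2 + 7 * x * y + 11 * y ^ 2], ?_⟩
  rw [Matrix.mulVec_smul]
  ext ξ
  fin_cases ξ <;>
  · simp [Lzero, L00, Lm0, L0m, Lx00, Lxm, Ly00, Lym]
    field_simp
    ring

lemma exists_Lzero_mulVec_xy {ω : ℝ × ℝ} (hx : 0 < ω.1) (hy : 0 < ω.2) :
    ∃ c : Fin 6 → ℝ, Lzero ω *ᵥ c = fun ξ =>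
      -(ω.1 * ![0, 0, -1, 0, 0, 1] ξ + ω.2 * ![0, -1, 0, 1, 0, 0] ξ) := by
  obtain ⟨x, y⟩ := ω
  simp only at hx hy
  have hxy : x + y ≠ 0 := by positivity
  refine ⟨(1 / (54 * x * y * (x + y))) • ![
    -x ^ 3 - 3 * x ^ 2 * y - 3 * x * y ^ 2 - y ^ 3,
    -x ^ 3 + 13 * x ^ 2 * y - 3 * x * y ^ 2 + y ^ 3,
    x ^ 3 - 3 * x ^ 2 * y + 13 * x * y ^ 2 - y ^ 3,
    x ^ 3 + 3 * x ^ 2 * y + x * y ^ 2 - y ^ 3,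
    x ^ 3 - 11 * x ^ 2 * y - 11 * x * y ^ 2 + y ^ 3,
    -x ^ 3 + x ^ 2 * y + 3 * x * y ^ 2 + y ^ 3], ?_⟩
  rw [Matrix.mulVec_smul]
  ext ξ
  fin_cases ξ <;>
  · simp [Lzero, L00, Lm0, L0m, Lx00, Lxm, Ly00, Lym]
    field_simp
    ring_nf <;> simp

lemma exists_Lzero_mulVec_yy {ω : ℝ × ℝ} (hx : 0 < ω.1) (hy : 0 < ω.2) :
    ∃ c : Fin 6 → ℝ, Lzero ω *ᵥ c = fun ξ => -(1 / 2 * (ω.2 * ![1, 1, -1, -1, -1, 1] ξ)) := by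
  obtain ⟨x, y⟩ := ω
  simp only at hx hy
  have hxy : x + y ≠ 0 := by positivity
  refine ⟨(1 / (108 * x * (x + y))) • ![
    -11 * x ^ 2 - 7 * x * y + y ^ 2, -11 * x ^ 2 + 7 * x * y - y ^ 2,
    11 * x ^ 2 - 5 * x * y + y ^ 2, 11 * x ^ 2 + 7 * x * y + y ^ 2,
    11 * x ^ 2 + 15 * x * y - y ^ 2, -11 * x ^ 2 - 17 * x * y - y ^ 2], ?_⟩
  rw [Matrix.mulVec_smul]
  ext ξ
  fin_cases ξ <;>
  · simp [Lzero, L00, Lm0, L0m, Lx00, Lxm, Ly00, Lym]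
    field_simp
    ring

lemma stencil_add (ω : ℝ × ℝ) (G G' : ℝ → ℝ → Fin 6 → ℝ) :
    stencil ω (fun m n ξ => G m n ξ + G' m n ξ) = stencil ω G + stencil ω G' := by
  have h : ∀ m n, (fun ξ => G m n ξ + G' m n ξ) = G m n + G' m n := fun _ _ => rfl
  simp only [stencil, h, Matrix.mulVec_add]
  abel

lemma stencil_const (ω : ℝ × ℝ) (g : Fin 6 → ℝ) : stencil ω (fun _ _ => g) = Lzero ω *ᵥ g := by
  simp only [stencil, Lzero, Matrix.add_mulVec]

/-- For positive velocities there is a correction making the scheme exact on quadratics. -/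
lemma exists_corrector_exact {ω : ℝ × ℝ} (hx : 0 < ω.1) (hy : 0 < ω.2) :
    ∃ c : Fin 3 → Fin 6 → ℝ, ∀ j a b A B C : ℝ,
      stencil ω (lift c (quadr j a b A B C)) = lift c (quadrDeriv ω a b A B C) 0 0 := by
  obtain ⟨cxx, hxx⟩ := exists_Lzero_mulVec_xx hx hy
  obtain ⟨cxy, hxy⟩ := exists_Lzero_mulVec_xy hx hy
  obtain ⟨cyy, hyy⟩ := exists_Lzero_mulVec_yy hx hy
  refine ⟨![cxx, cxy, cyy], fun j a b A B C => ?_⟩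
  have hl : lift ![cxx, cxy, cyy] (quadr j a b A B C) = fun m n ξ =>
      quadr j a b A B C (m + (apt ξ).1) (n + (apt ξ).2)
        + (A • cxx + B • cxy + C • cyy) ξ := by
    funext m n ξ
    simp [lift, corrector_quadr]
  rw [hl, stencil_add ω (fun m n ξ => quadr j a b A B C (m + (apt ξ).1) (n + (apt ξ).2))
    (fun _ _ => A • cxx + B • cxy + C • cyy), stencil_quadr, stencil_const]
  simp only [Matrix.mulVec_add, Matrix.mulVec_smul, hxx, hxy, hyy]
  ext ξ
  simp only [Pi.add_apply, Pi.smul_apply, smul_eq_mul, lift, corrector_quadrDeriv, zero_add]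
  ring
lemma abs_mulVec_le (A : Matrix (Fin 6) (Fin 6) ℝ) {g : Fin 6 → ℝ} {δ : ℝ}
    (hg : ∀ ξ, |g ξ| ≤ δ) (i : Fin 6) : |(A *ᵥ g) i| ≤ (∑ i, ∑ j, |A i j|) * δ := by
  have hδ : 0 ≤ δ := (abs_nonneg _).trans (hg 0)
  calc |(A *ᵥ g) i| ≤ ∑ j, |A i j * g j| := by
        simp only [Matrix.mulVec, dotProduct]
        exact Finset.abs_sum_le_sum_abs _ _
    _ ≤ ∑ j, |A i j| * δ := Finset.sum_le_sum fun j _ => by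
        rw [abs_mul]; exact mul_le_mul_of_nonneg_left (hg j) (abs_nonneg _)
    _ = (∑ j, |A i j|) * δ := (Finset.sum_mul _ _ _).symm
    _ ≤ _ := mul_le_mul_of_nonneg_right
        (Finset.single_le_sum (f := fun i => ∑ j, |A i j|)
          (fun i _ => Finset.sum_nonneg fun j _ => abs_nonneg _) (Finset.mem_univ i)) hδ

lemma exists_abs_stencil_le (ω : ℝ × ℝ) : ∃ M, 0 ≤ M ∧ ∀ (G : ℝ → ℝ → Fin 6 → ℝ) (δ : ℝ),
    (∀ m n ξ, |m| ≤ 1 → |n| ≤ 1 → |G m n ξ| ≤ δ) → ∀ ξ, |stencil ω G ξ| ≤ M * δ := by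
  refine ⟨(∑ i, ∑ j, |L00 ω i j|) + (∑ i, ∑ j, |Lm0 ω i j|) + ∑ i, ∑ j, |L0m ω i j|,
    by positivity, fun G δ hG ξ => ?_⟩
  have h1 := abs_mulVec_le (L00 ω) (fun ξ => hG 0 0 ξ (by simp) (by simp)) ξ
  have h2 := abs_mulVec_le (Lm0 ω) (fun ξ => hG (-1) 0 ξ (by simp) (by simp)) ξ
  have h3 := abs_mulVec_le (L0m ω) (fun ξ => hG 0 (-1) ξ (by simp) (by simp)) ξ
  simp only [stencil, Pi.add_apply]
  refine (abs_add_three _ _ _).trans ?_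
  linarith

lemma abs_apt_le (ξ : Fin 6) : |(apt ξ).1| ≤ 1 ∧ |(apt ξ).2| ≤ 1 := by
  fin_cases ξ <;> simp [apt]

lemma exists_abs_corrector_le (c : Fin 3 → Fin 6 → ℝ) : ∃ M, 0 ≤ M ∧
    ∀ (F : ℝ → ℝ → ℝ) (δ : ℝ), (∀ m n, |m| ≤ 2 → |n| ≤ 2 → |F m n| ≤ δ) →
      ∀ m n ξ, |m| ≤ 1 → |n| ≤ 1 → |corrector c F m n ξ| ≤ M * δ := by
  refine ⟨4 * ∑ k, ∑ ξ, |c k ξ|, by positivity, fun F δ hF m n ξ hm hn => ?_⟩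
  have hδ : 0 ≤ δ := (abs_nonneg _).trans (hF 0 0 (by simp) (by simp))
  obtain ⟨m1, m2⟩ := abs_le.1 hm
  obtain ⟨n1, n2⟩ := abs_le.1 hn
  have hc : ∀ k, |c k ξ| ≤ ∑ ξ, |c k ξ| := fun k =>
    Finset.single_le_sum (f := fun ξ => |c k ξ|) (fun _ _ => abs_nonneg _) (Finset.mem_univ ξ)
  have hF' : ∀ m n, -2 ≤ m → m ≤ 2 → -2 ≤ n → n ≤ 2 → -δ ≤ F m n ∧ F m n ≤ δ :=
    fun m n h1 h2 h3 h4 => abs_le.1 (hF m n (abs_le.2 ⟨h1, h2⟩) (abs_le.2 ⟨h3, h4⟩))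
  have f0 := hF' m n (by linarith) (by linarith) (by linarith) (by linarith)
  have f1 := hF' (m + 1) n (by linarith) (by linarith) (by linarith) (by linarith)
  have f2 := hF' (m - 1) n (by linarith) (by linarith) (by linarith) (by linarith)
  have f3 := hF' m (n + 1) (by linarith) (by linarith) (by linarith) (by linarith)
  have f4 := hF' m (n - 1) (by linarith) (by linarith) (by linarith) (by linarith)
  have f5 := hF' (m + 1) (n + 1) (by linarith) (by linarith) (by linarith) (by linarith)
  have key : ∀ k s, |s| ≤ 4 * δ → |c k ξ * s| ≤ (∑ ξ, |c k ξ|) * (4 * δ) := fun k s hs => by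
    rw [abs_mul]
    exact mul_le_mul (hc k) hs (abs_nonneg _) (by positivity)
  have k0 := key 0 (F (m + 1) n - 2 * F m n + F (m - 1) n)
    (abs_le.2 ⟨by linarith, by linarith⟩)
  have k1 := key 1 (F (m + 1) (n + 1) - F (m + 1) n - F m (n + 1) + F m n)
    (abs_le.2 ⟨by linarith, by linarith⟩)
  have k2 := key 2 (F m (n + 1) - 2 * F m n + F m (n - 1))
    (abs_le.2 ⟨by linarith, by linarith⟩)
  refine (abs_add_three _ _ _).trans ?_
  rw [Fin.sum_univ_three (fun k => ∑ ξ, |c k ξ|)]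
  linarith

lemma exists_abs_lift_le (c : Fin 3 → Fin 6 → ℝ) : ∃ M, 0 ≤ M ∧
    ∀ (F : ℝ → ℝ → ℝ) (δ : ℝ), (∀ m n, |m| ≤ 2 → |n| ≤ 2 → |F m n| ≤ δ) →
      ∀ m n ξ, |m| ≤ 1 → |n| ≤ 1 → |lift c F m n ξ| ≤ M * δ := by
  obtain ⟨M, hM, hc⟩ := exists_abs_corrector_le c
  refine ⟨1 + M, by positivity, fun F δ hF m n ξ hm hn => ?_⟩
  obtain ⟨ha, hb⟩ := abs_apt_le ξ
  have h1 := hF (m + (apt ξ).1) (n + (apt ξ).2) ((abs_add_le _ _).trans (by linarith))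
    ((abs_add_le _ _).trans (by linarith))
  have h2 := hc F δ hF m n ξ hm hn
  refine (abs_add_le _ _).trans ?_
  linarith

lemma corrector_sub (c : Fin 3 → Fin 6 → ℝ) (F F' : ℝ → ℝ → ℝ) (m n : ℝ) (ξ : Fin 6) :
    corrector c (fun m n => F m n - F' m n) m n ξ = corrector c F m n ξ - corrector c F' m n ξ := by
  simp only [corrector]
  ring

lemma lift_sub (c : Fin 3 → Fin 6 → ℝ) (F F' : ℝ → ℝ → ℝ) (m n : ℝ) (ξ : Fin 6) :
    lift c (fun m n => F m n - F' m n) m n ξ = lift c F m n ξ - lift c F' m n ξ := by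
  simp only [lift, corrector_sub]
  ring

lemma lift_const_mul (c : Fin 3 → Fin 6 → ℝ) (k : ℝ) (F : ℝ → ℝ → ℝ) (m n : ℝ) (ξ : Fin 6) :
    lift c (fun m n => k * F m n) m n ξ = k * lift c F m n ξ := by
  simp only [lift, corrector]
  ring

lemma norm_smul_pair_le {h m n : ℝ} (hh : 0 ≤ h) (hm : |m| ≤ 2) (hn : |n| ≤ 2) :
    ‖h • ((m, n) : ℝ × ℝ)‖ ≤ 2 * h := by
  rw [norm_smul, Real.norm_of_nonneg hh, mul_comm]
  exact mul_le_mul_of_nonneg_right (max_le hm hn) hh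

/-- The correction of the samples of a periodic `C³` function is of second order. -/
lemma exists_abs_corrector_sample_le (c : Fin 3 → Fin 6 → ℝ) {v : ℝ × ℝ → ℝ}
    (hp : Periodic2 v) (hv : ContDiff ℝ 3 v) : ∃ K, 0 ≤ K ∧ ∀ h, 0 ≤ h → ∀ p ξ,
      |corrector c (fun m n => v (p + h • (m, n))) 0 0 ξ| ≤ K * h ^ 2 := by
  obtain ⟨K, hK, hb, -⟩ := exists_bound_fderiv_of_periodic hp hv
  obtain ⟨M, hM, hc⟩ := exists_abs_corrector_le c
  refine ⟨M * (K * 4), by positivity, fun h hh p ξ => ?_⟩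
  set D := fderiv ℝ v p
  have hJ : ∀ m n, quadr (v p) (h * D (1, 0)) (h * D (0, 1)) 0 0 0 m n
      = v p + D (h • (m, n)) := by
    intro m n
    have : h • ((m, n) : ℝ × ℝ) = (h * m) • (1, 0) + (h * n) • (0, 1) := by ext <;> simp
    rw [this]
    simp only [map_add, map_smul, smul_eq_mul, quadr]
    ring
  have := hc (fun m n => v (p + h • (m, n))
      - quadr (v p) (h * D (1, 0)) (h * D (0, 1)) 0 0 0 m n) (K * (2 * h) ^ 2) (by
    intro m n hm hn
    rw [hJ, ← sub_sub]
    have := taylor_estimate_one (hv.of_le (by norm_num)) hK hb p (p + h • (m, n))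
    rw [add_sub_cancel_left] at this
    refine this.trans ?_
    gcongr
    exact norm_smul_pair_le hh hm hn) 0 0 ξ (by simp) (by simp)
  rw [corrector_sub c (fun m n => v (p + h • (m, n))), corrector_quadr] at this
  calc _ ≤ _ := by simpa using this
    _ = _ := by ring

set_option maxSynthPendingDepth 6 in
/-- With a correction exact on quadratics, the truncation error is of second order. -/
lemma exists_truncation_le {ω : ℝ × ℝ} {c : Fin 3 → Fin 6 → ℝ}
    (hc : ∀ j a b A B C : ℝ,
      stencil ω (lift c (quadr j a b A B C)) = lift c (quadrDeriv ω a b A B C) 0 0)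
    {v : ℝ × ℝ → ℝ} (hp : Periodic2 v) (hv : ContDiff ℝ 3 v) :
    ∃ K, 0 ≤ K ∧ ∀ h, 0 ≤ h → ∀ p ξ,
      |stencil ω (lift c (fun m n => v (p + h • (m, n)))) ξ
        - h * lift c (fun m n => fderiv ℝ v (p + h • (m, n)) ω) 0 0 ξ| ≤ K * h ^ 3 := by
  obtain ⟨K, hK, -, hb⟩ := exists_bound_fderiv_of_periodic hp hv
  obtain ⟨M, hM, hl⟩ := exists_abs_lift_le c
  obtain ⟨S, hS, hs⟩ := exists_abs_stencil_le ω
  refine ⟨S * (M * (K * 8)) + M * (K * 4 * ‖ω‖), by positivity, fun h hh p ξ => ?_⟩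
  have h1 : ContDiff ℝ 2 (fderiv ℝ v) := hv.fderiv_right (by norm_num)
  set D := fderiv ℝ v p with hD
  set Q := fderiv ℝ (fderiv ℝ v) p with hQ
  have hsymm : ∀ a b, Q a b = Q b a :=
    second_derivative_symmetric (fun x => (hv.differentiable (by norm_num) x).hasFDerivAt)
      (h1.differentiable (by norm_num) p).hasFDerivAt
  set J := quadr (v p) (h * D (1, 0)) (h * D (0, 1)) (h ^ 2 * Q (1, 0) (1, 0))
    (h ^ 2 * Q (1, 0) (0, 1)) (h ^ 2 * Q (0, 1) (0, 1)) with hJdef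
  set J' := quadrDeriv ω (h * D (1, 0)) (h * D (0, 1)) (h ^ 2 * Q (1, 0) (1, 0))
    (h ^ 2 * Q (1, 0) (0, 1)) (h ^ 2 * Q (0, 1) (0, 1)) with hJdef'
  have hpair : ∀ m n : ℝ, h • ((m, n) : ℝ × ℝ) = (h * m) • (1, 0) + (h * n) • (0, 1) := by
    intro m n; ext <;> simp
  have hω : ω = ω.1 • (1, 0) + ω.2 • (0, 1) := by ext <;> simp
  have hJ : ∀ m n, J m n = v p + D (h • (m, n)) + Q (h • (m, n)) (h • (m, n)) / 2 := by
    intro m n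
    rw [hpair]
    simp only [map_add, map_smul, smul_eq_mul, _root_.add_apply,
      _root_.smul_apply, hJdef, quadr, hsymm (0, 1) (1, 0)]
    ring
  have hJ' : ∀ m n, J' m n = h * (D ω + Q (h • (m, n)) ω) := by
    intro m n
    rw [hpair]
    nth_rewrite 1 [hω]
    nth_rewrite 3 [hω]
    simp only [map_add, map_smul, smul_eq_mul, _root_.add_apply,
      _root_.smul_apply, hJdef', quadrDeriv, hsymm (0, 1) (1, 0)]
    ring
  have r0 : ∀ m n, |m| ≤ 2 → |n| ≤ 2 → |v (p + h • (m, n)) - J m n| ≤ K * (2 * h) ^ 3 := by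
    intro m n hm hn
    have := (taylor_estimates hv hK hb p (p + h • (m, n))).2
    rw [add_sub_cancel_left, ← hD, ← hQ] at this
    rw [hJ, ← sub_sub, ← sub_sub]
    refine this.trans ?_
    gcongr
    exact norm_smul_pair_le hh hm hn
  have r1 : ∀ m n, |m| ≤ 2 → |n| ≤ 2 →
      |h * fderiv ℝ v (p + h • (m, n)) ω - J' m n| ≤ h * (K * (2 * h) ^ 2 * ‖ω‖) := by
    intro m n hm hn
    have := (taylor_estimates hv hK hb p (p + h • (m, n))).1
    rw [add_sub_cancel_left, ← hD, ← hQ] at this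
    rw [hJ', ← mul_sub, abs_mul, abs_of_nonneg hh, ← sub_sub]
    refine mul_le_mul_of_nonneg_left ?_ hh
    refine ((fderiv ℝ v (p + h • (m, n)) - D - Q (h • (m, n))).le_opNorm ω).trans ?_
    gcongr
    refine this.trans ?_
    gcongr
    exact norm_smul_pair_le hh hm hn
  have e0 := hs (fun m n ξ => lift c (fun m n => v (p + h • (m, n)) - J m n) m n ξ) _
    (fun m n ξ hm hn => hl _ _ r0 m n ξ hm hn) ξ
  have e1 := hl _ _ r1 0 0 ξ (by simp) (by simp)
  rw [lift_sub c (fun m n => h * fderiv ℝ v (p + h • (m, n)) ω),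
    lift_const_mul c h (fun m n => fderiv ℝ v (p + h • (m, n)) ω)] at e1
  have hst : stencil ω (fun m n ξ => lift c (fun m n => v (p + h • (m, n)) - J m n) m n ξ) ξ
      = stencil ω (lift c (fun m n => v (p + h • (m, n)))) ξ - lift c J' 0 0 ξ := by
    rw [← hc, eq_sub_iff_add_eq, ← Pi.add_apply, ← stencil_add]
    congr 2
    funext m n ξ
    rw [lift_sub c (fun m n => v (p + h • (m, n)))]
    ring
  rw [hst] at e0
  calc _ = |(stencil ω (lift c (fun m n => v (p + h • (m, n)))) ξ - lift c J' 0 0 ξ)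
        - (h * lift c (fun m n => fderiv ℝ v (p + h • (m, n)) ω) 0 0 ξ - lift c J' 0 0 ξ)| := by
        congr 1; ring
    _ ≤ _ := (abs_sub _ _).trans (add_le_add e0 e1)
    _ = _ := by ring

lemma three_mul_sum_sq_le_blockForm (u : Fin 6 → ℝ) : 3 * ∑ ξ, u ξ ^ 2 ≤ blockForm u u := by
  simp only [blockForm, ← sq]
  nlinarith [sq_nonneg (u 0 + u 1 + u 2), sq_nonneg (u 3 + u 4 + u 5)]

lemma blockForm_self_nonneg (u : Fin 6 → ℝ) : 0 ≤ blockForm u u :=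
  le_trans (by positivity) (three_mul_sum_sq_le_blockForm u)

lemma blockForm_self_le {u : Fin 6 → ℝ} {δ : ℝ} (hu : ∀ ξ, |u ξ| ≤ δ) :
    blockForm u u ≤ 54 * δ ^ 2 := by
  have h : ∀ ξ, u ξ ^ 2 ≤ δ ^ 2 := fun ξ => sq_le_sq.2 ((hu ξ).trans (le_abs_self δ))
  simp only [blockForm, Fin.sum_univ_six]
  nlinarith [h 0, h 1, h 2, h 3, h 4, h 5, sq_nonneg (u 0 - u 1), sq_nonneg (u 0 - u 2),
    sq_nonneg (u 1 - u 2), sq_nonneg (u 3 - u 4), sq_nonneg (u 3 - u 5), sq_nonneg (u 4 - u 5)]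

lemma neg_two_mul_blockForm_le (u w : Fin 6 → ℝ) {l : ℝ} (hl : 0 < l) :
    -2 * blockForm u w ≤ l * blockForm u u + l⁻¹ * blockForm w w := by
  have h := mul_nonneg (inv_nonneg.2 hl.le) (blockForm_self_nonneg (fun ξ => l * u ξ + w ξ))
  have h' : l⁻¹ * blockForm (fun ξ => l * u ξ + w ξ) (fun ξ => l * u ξ + w ξ)
      = l * blockForm u u + 2 * blockForm u w + l⁻¹ * blockForm w w := by
    simp only [blockForm, Fin.sum_univ_six]
    field_simp
    ring
  linarith

lemma blockForm_sub_smul (u a b : Fin 6 → ℝ) (k : ℝ) :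
    blockForm u (-(k • a) - b) = -k * blockForm u a - blockForm u b := by
  simp [blockForm, Fin.sum_univ_six]
  ring

lemma HasDerivAt.blockForm_self {f : ℝ → Fin 6 → ℝ} {f' : Fin 6 → ℝ} {t : ℝ}
    (hf : HasDerivAt f f' t) :
    HasDerivAt (fun s => blockForm (f s) (f s)) (2 * blockForm (f t) f') t := by
  have h := hasDerivAt_pi.1 hf
  have hsum := HasDerivAt.fun_sum (u := Finset.univ) fun ξ _ => (h ξ).mul (h ξ)
  have h1 := ((h 0).add (h 1)).add (h 2)
  have h2 := ((h 3).add (h 4)).add (h 5)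
  have := ((hsum.const_mul 3).add ((h1.const_mul 2).mul h1)).add ((h2.const_mul 2).mul h2)
  refine this.congr_deriv ?_
  simp [blockForm, Fin.sum_univ_six]
  ring

section Energy

variable {N : ℕ} [NeZero N]

/-- The dissipated energy of a mesh function. -/
def energy (N : ℕ) [NeZero N] (u : Mesh N) : ℝ :=
  ∑ η : ZMod N × ZMod N, ((1 : ℝ) / N) ^ 2 * blockForm (u η) (u η)

lemma sum_const_mesh (k : ℝ) : ∑ _η : ZMod N × ZMod N, ((1 : ℝ) / N) ^ 2 * k = k := by
  have : (N : ℝ) ≠ 0 := Nat.cast_ne_zero.2 (NeZero.ne N)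
  simp [ZMod.card]
  field_simp

lemma energy_nonneg (u : Mesh N) : 0 ≤ energy N u :=
  Finset.sum_nonneg fun _ _ => mul_nonneg (by positivity) (blockForm_self_nonneg _)

lemma energy_le {u : Mesh N} {δ : ℝ} (hu : ∀ η ξ, |u η ξ| ≤ δ) : energy N u ≤ 54 * δ ^ 2 := by
  rw [← sum_const_mesh (N := N) (54 * δ ^ 2)]
  exact Finset.sum_le_sum fun η _ =>
    mul_le_mul_of_nonneg_left (blockForm_self_le (hu η)) (by positivity)

lemma meshNorm_le_sqrt_energy (u : Mesh N) : meshNorm N u ≤ √(energy N u) := by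
  refine Real.sqrt_le_sqrt (Finset.sum_le_sum fun η _ =>
    mul_le_mul_of_nonneg_left ?_ (by positivity))
  have := three_mul_sum_sq_le_blockForm (u η)
  have : 0 ≤ ∑ ξ, u η ξ ^ 2 := by positivity
  linarith

lemma sum_mesh_shift (g : ZMod N × ZMod N → ℝ) (ζ : ZMod N × ZMod N) :
    ∑ η, g (η + ζ) = ∑ η, g η :=
  Equiv.sum_comp (Equiv.addRight ζ) g

/-- The right-hand side of the scheme is dissipative in the energy. -/
lemma sum_blockForm_scheme_nonneg {ω : ℝ × ℝ} (hx : 0 ≤ ω.1) (hy : 0 ≤ ω.2) (u : Mesh N) :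
    0 ≤ ∑ η : ZMod N × ZMod N, ((1 : ℝ) / N) ^ 2 * blockForm (u η)
      (L00 ω *ᵥ u η + Lm0 ω *ᵥ u (η + (-1, 0)) + L0m ω *ᵥ u (η + (0, -1))) := by
  rw [← Finset.mul_sum]
  refine mul_nonneg (by positivity) ?_
  set gx : ZMod N × ZMod N → ℝ := fun η =>
    9 * (ω.1 * (u η 4 ^ 2 + u η 4 * u η 5 + u η 5 ^ 2)) with hgx
  set gy : ZMod N × ZMod N → ℝ := fun η =>
    9 * (ω.2 * (u η 3 ^ 2 + u η 3 * u η 4 + u η 4 ^ 2)) with hgy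
  have h0 : ∑ η, ((gx η - gx (η + (-1, 0))) + (gy η - gy (η + (0, -1)))) = 0 := by
    simp only [Finset.sum_add_distrib, Finset.sum_sub_distrib]
    rw [sum_mesh_shift gx, sum_mesh_shift gy]
    ring
  rw [← h0]
  refine Finset.sum_le_sum fun η _ => ?_
  refine le_trans (le_of_eq ?_) (blockForm_dissipation hx hy (u η) _ _)
  simp only [hgx, hgy]
  ring

/-- Stability of the scheme with respect to the initial data and the right-hand side. -/
lemma meshNorm_le_of_scheme {ω : ℝ × ℝ} (hx : 0 ≤ ω.1) (hy : 0 ≤ ω.2) {e R : ℝ → Mesh N}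
    (he : ∀ η t, HasDerivAt (fun s => e s η)
      (-((N : ℝ) • (L00 ω *ᵥ e t η + Lm0 ω *ᵥ e t (η + (-1, 0)) + L0m ω *ᵥ e t (η + (0, -1))))
        - R t η) t)
    {δ ρ : ℝ} (hδ : 0 < δ) (hρ : 0 < ρ) (h0 : ∀ η ξ, |e 0 η ξ| ≤ δ)
    (hR : ∀ t η ξ, |R t η ξ| ≤ ρ) {t : ℝ} (ht : 0 ≤ t) :
    meshNorm N (e t) ≤ 8 * δ + 8 * ρ * t := by
  have hE : ∀ t, HasDerivAt (fun s => energy N (e s))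
      (∑ η : ZMod N × ZMod N, ((1 : ℝ) / N) ^ 2 * (2 * blockForm (e t η)
        (-((N : ℝ) • (L00 ω *ᵥ e t η + Lm0 ω *ᵥ e t (η + (-1, 0))
          + L0m ω *ᵥ e t (η + (0, -1)))) - R t η))) t := fun t =>
    HasDerivAt.fun_sum fun η _ => (he η t).blockForm_self.const_mul _
  have hpos : ∀ t, 0 < energy N (e t) + δ ^ 2 := fun t => by
    have := energy_nonneg (e t); positivity
  have hf : ∀ t, HasDerivAt (fun s => √(energy N (e s) + δ ^ 2) - 8 * ρ * s) _ t := fun t =>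
    (((hE t).add_const (δ ^ 2)).sqrt (hpos t).ne').sub ((hasDerivAt_id t).const_mul (8 * ρ))
  have hanti : Antitone (fun s => √(energy N (e s) + δ ^ 2) - 8 * ρ * s) := by
    refine antitone_of_hasDerivAt_nonpos hf fun t => ?_
    set f := √(energy N (e t) + δ ^ 2) with hfdef
    have hfpos : 0 < f := Real.sqrt_pos.2 (hpos t)
    have hfsq : f ^ 2 = energy N (e t) + δ ^ 2 := Real.sq_sqrt (hpos t).le
    rw [mul_one]
    refine sub_nonpos.2 ((div_le_iff₀ (by positivity)).2 ?_)
    have hdiss := sum_blockForm_scheme_nonneg hx hy (e t)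
    have hl : 0 < 8 * ρ / f := by positivity
    have hRs : energy N (R t) ≤ 64 * ρ ^ 2 :=
      (energy_le (hR t)).trans (by nlinarith [sq_nonneg ρ])
    calc _ = -(2 * N) * ∑ η : ZMod N × ZMod N, ((1 : ℝ) / N) ^ 2 * blockForm (e t η)
            (L00 ω *ᵥ e t η + Lm0 ω *ᵥ e t (η + (-1, 0)) + L0m ω *ᵥ e t (η + (0, -1)))
          + ∑ η : ZMod N × ZMod N, ((1 : ℝ) / N) ^ 2 * (-2 * blockForm (e t η) (R t η)) := by
          rw [Finset.mul_sum, ← Finset.sum_add_distrib]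
          refine Finset.sum_congr rfl fun η _ => ?_
          rw [blockForm_sub_smul]
          ring
      _ ≤ 0 + ∑ η : ZMod N × ZMod N, ((1 : ℝ) / N) ^ 2 *
            (8 * ρ / f * blockForm (e t η) (e t η)
              + (8 * ρ / f)⁻¹ * blockForm (R t η) (R t η)) := by
          refine add_le_add ?_ (Finset.sum_le_sum fun η _ =>
            mul_le_mul_of_nonneg_left (neg_two_mul_blockForm_le _ _ hl) (by positivity))
          have : (0 : ℝ) ≤ N := Nat.cast_nonneg N
          nlinarith
      _ = 8 * ρ / f * energy N (e t) + (8 * ρ / f)⁻¹ * energy N (R t) := by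
          rw [zero_add, energy, energy, Finset.mul_sum, Finset.mul_sum, ← Finset.sum_add_distrib]
          exact Finset.sum_congr rfl fun η _ => by ring
      _ ≤ 8 * ρ / f * f ^ 2 + (8 * ρ / f)⁻¹ * (64 * ρ ^ 2) := by
          gcongr
          rw [hfsq]
          nlinarith [sq_nonneg δ]
      _ = _ := by
          field_simp
          ring
  have h1 := hanti ht
  simp only [mul_zero, sub_zero] at h1
  have h2 : √(energy N (e 0) + δ ^ 2) ≤ 8 * δ :=
    Real.sqrt_le_iff.2 ⟨by positivity, by nlinarith [energy_le h0, sq_nonneg δ]⟩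
  have h3 : √(energy N (e t)) ≤ √(energy N (e t) + δ ^ 2) :=
    Real.sqrt_le_sqrt (by nlinarith [sq_nonneg δ])
  linarith [meshNorm_le_sqrt_energy (e t)]

end Energy

section SecondOrder

lemma meshNorm_add_le {N : ℕ} [NeZero N] (a : Mesh N) {b : Mesh N} {δ : ℝ}
    (hδ : 0 ≤ δ) (hb : ∀ η ξ, |b η ξ| ≤ δ) : meshNorm N (a + b) ≤ 2 * meshNorm N a + 4 * δ := by
  have hm : 0 ≤ meshNorm N a := Real.sqrt_nonneg _
  refine Real.sqrt_le_iff.2 ⟨by positivity, ?_⟩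
  have hsq : meshNorm N a ^ 2 = ∑ η : ZMod N × ZMod N, ((1 : ℝ) / N) ^ 2 * ∑ ξ, a η ξ ^ 2 :=
    Real.sq_sqrt (by positivity)
  calc _ ≤ ∑ η : ZMod N × ZMod N, (2 * (((1 : ℝ) / N) ^ 2 * ∑ ξ, a η ξ ^ 2)
          + ((1 : ℝ) / N) ^ 2 * (12 * δ ^ 2)) := by
        refine Finset.sum_le_sum fun η _ => ?_
        have h : ∑ ξ, (a + b) η ξ ^ 2 ≤ ∑ ξ, (2 * a η ξ ^ 2 + 2 * δ ^ 2) := by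
          refine Finset.sum_le_sum fun ξ _ => ?_
          have h1 : b η ξ ^ 2 ≤ δ ^ 2 := sq_le_sq.2 ((hb η ξ).trans (le_abs_self δ))
          simp only [Pi.add_apply]
          nlinarith [sq_nonneg (a η ξ - b η ξ)]
        rw [Finset.sum_add_distrib, ← Finset.mul_sum] at h
        simp only [Finset.sum_const, Finset.card_univ, Fintype.card_fin] at h
        refine (mul_le_mul_of_nonneg_left h (by positivity)).trans_eq ?_
        rw [nsmul_eq_mul]
        push_cast
        ring
    _ = 2 * meshNorm N a ^ 2 + 12 * δ ^ 2 := by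
        rw [Finset.sum_add_distrib, ← Finset.mul_sum, sum_const_mesh, hsq]
    _ ≤ _ := by nlinarith [mul_nonneg hm hδ]

lemma Periodic2.add_int {v : ℝ × ℝ → ℝ} (hp : Periodic2 v) (k l : ℤ) (r : ℝ × ℝ) :
    v (r + ((k : ℝ), (l : ℝ))) = v r := by
  have p1 : Function.Periodic (fun x => v (x, r.2 + l)) 1 := fun x => hp.1 x _
  have p2 : Function.Periodic (fun y => v (r.1, y)) 1 := fun y => hp.2 _ y
  have h1 := p1.int_mul k r.1
  have h2 := p2.int_mul l r.2
  simp only [mul_one] at h1 h2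
  exact h1.trans h2

lemma ZMod.exists_val_add_neg_one {N : ℕ} [NeZero N] (x : ZMod N) :
    ∃ k : ℤ, ((x + -1).val : ℝ) = x.val - 1 + k * N := by
  have h : (N : ℤ) ∣ ((x + -1).val - x.val + 1 : ℤ) := by
    rw [← ZMod.intCast_zmod_eq_zero_iff_dvd]
    push_cast
    simp
  obtain ⟨k, hk⟩ := h
  refine ⟨k, ?_⟩
  have := congrArg (Int.cast : ℤ → ℝ) hk
  push_cast at this
  linarith

/-- The corner of the block `η`, followed back along the characteristics. -/
def corner (ω : ℝ × ℝ) (N : ℕ) (t : ℝ) (η : ZMod N × ZMod N) : ℝ × ℝ :=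
  ((η.1.val : ℝ) / N, (η.2.val : ℝ) / N) - t • ω

/-- Samples of the exact solution on the lattice around the block `η`. -/
def sample (ω : ℝ × ℝ) (N : ℕ) (v : ℝ × ℝ → ℝ) (t : ℝ) (η : ZMod N × ZMod N) (m n : ℝ) : ℝ :=
  v (corner ω N t η + ((1 : ℝ) / N) • (m, n))

variable {N : ℕ} [NeZero N] {ω : ℝ × ℝ} {v : ℝ × ℝ → ℝ}

lemma Pih_apply_eq_sample (t : ℝ) (η : ZMod N × ZMod N) (ξ : Fin 6) :
    Pih N (fun r => v (r - t • ω)) η ξ = sample ω N v t η (apt ξ).1 (apt ξ).2 := by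
  simp only [Pih, sample, corner]
  congr 1
  ext
  · simp; ring
  · simp; ring

lemma sample_shift_left (hp : Periodic2 v) (t : ℝ) (η : ZMod N × ZMod N) (m n : ℝ) :
    sample ω N v t (η + (-1, 0)) m n = sample ω N v t η (m - 1) n := by
  have hN : (N : ℝ) ≠ 0 := Nat.cast_ne_zero.2 (NeZero.ne N)
  obtain ⟨k, hk⟩ := ZMod.exists_val_add_neg_one η.1
  simp only [sample]
  rw [← hp.add_int k 0 (corner ω N t η + ((1 : ℝ) / N) • (m - 1, n))]
  congr 1
  ext
  · simp [corner, hk]; field_simp; ring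
  · simp [corner]

lemma sample_shift_down (hp : Periodic2 v) (t : ℝ) (η : ZMod N × ZMod N) (m n : ℝ) :
    sample ω N v t (η + (0, -1)) m n = sample ω N v t η m (n - 1) := by
  have hN : (N : ℝ) ≠ 0 := Nat.cast_ne_zero.2 (NeZero.ne N)
  obtain ⟨k, hk⟩ := ZMod.exists_val_add_neg_one η.2
  simp only [sample]
  rw [← hp.add_int 0 k (corner ω N t η + ((1 : ℝ) / N) • (m, n - 1))]
  congr 1
  ext
  · simp [corner]
  · simp [corner, hk]; field_simp; ring

lemma hasDerivAt_sample (hv : ContDiff ℝ 3 v) (t : ℝ) (η : ZMod N × ZMod N) (m n : ℝ) :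
    HasDerivAt (fun s => sample ω N v s η m n)
      (-(fderiv ℝ v (corner ω N t η + ((1 : ℝ) / N) • (m, n)) ω)) t := by
  have h1 : HasDerivAt (fun s => corner ω N s η + ((1 : ℝ) / N) • ((m, n) : ℝ × ℝ)) (-ω) t := by
    have := (((hasDerivAt_id t).smul_const ω).const_sub
      ((η.1.val : ℝ) / N, (η.2.val : ℝ) / N)).add_const (((1 : ℝ) / N) • ((m, n) : ℝ × ℝ))
    simpa [corner] using this
  have h2 := (hv.differentiable (by norm_num)
    (corner ω N t η + ((1 : ℝ) / N) • (m, n))).hasFDerivAt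
  have := h2.comp_hasDerivAt t h1
  rwa [map_neg] at this

lemma hasDerivAt_lift (c : Fin 3 → Fin 6 → ℝ) {F : ℝ → ℝ → ℝ → ℝ} {F' : ℝ → ℝ → ℝ} {t : ℝ}
    (hF : ∀ m n, HasDerivAt (fun s => F s m n) (F' m n) t) (m n : ℝ) :
    HasDerivAt (fun s => lift c (F s) m n) (lift c F' m n) t := by
  refine hasDerivAt_pi.2 fun ξ => ?_
  simp only [lift, corrector]
  exact (hF _ _).add ((((((hF _ _).sub ((hF _ _).const_mul 2)).add (hF _ _)).const_mul _).add
    (((((hF _ _).sub (hF _ _)).sub (hF _ _)).add (hF _ _)).const_mul _)).add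
    ((((hF _ _).sub ((hF _ _).const_mul 2)).add (hF _ _)).const_mul _))

lemma lift_translate (c : Fin 3 → Fin 6 → ℝ) (F : ℝ → ℝ → ℝ) (a b : ℝ) :
    lift c (fun m n => F (m + a) (n + b)) 0 0 = lift c F a b := by
  funext ξ
  simp only [lift, corrector]
  ring_nf

/-- The corrected projection satisfies the scheme up to the truncation error. -/
lemma stencil_sample (hp : Periodic2 v) (c : Fin 3 → Fin 6 → ℝ) (t : ℝ)
    (η : ZMod N × ZMod N) :
    L00 ω *ᵥ lift c (sample ω N v t η) 0 0 + Lm0 ω *ᵥ lift c (sample ω N v t (η + (-1, 0))) 0 0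
      + L0m ω *ᵥ lift c (sample ω N v t (η + (0, -1))) 0 0
      = stencil ω (lift c (sample ω N v t η)) := by
  have h1 : sample ω N v t (η + (-1, 0)) = fun m n => sample ω N v t η (m + -1) (n + 0) := by
    funext m n
    rw [sample_shift_left hp, add_zero, sub_eq_add_neg]
  have h2 : sample ω N v t (η + (0, -1)) = fun m n => sample ω N v t η (m + 0) (n + -1) := by
    funext m n
    rw [sample_shift_down hp, add_zero, sub_eq_add_neg]
  rw [h1, h2, lift_translate, lift_translate]
  rfl

end SecondOrder

lemma hasOrder_two {ω : ℝ × ℝ} (hx : 0 < ω.1) (hy : 0 < ω.2) : HasOrder ω 2 := by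
  intro v hp hv
  replace hv : ContDiff ℝ 3 v := by simpa using hv
  obtain ⟨c, hc⟩ := exists_corrector_exact hx hy
  obtain ⟨K, hK, hcorr⟩ := exists_abs_corrector_sample_le c hp hv
  obtain ⟨T, hT, htrunc⟩ := exists_truncation_le hc hp hv
  refine ⟨20 * (K + 1), 16 * (T + 1), by positivity, by positivity, ?_⟩
  intro N _ u hu hu0 t ht
  have hN : (0 : ℝ) < N := Nat.cast_pos.2 (NeZero.pos N)
  set h : ℝ := 1 / N with hh
  have hhpos : 0 < h := by positivity
  have hNh : N * h = 1 := by rw [hh]; field_simp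
  set w : ℝ → Mesh N := fun t η => lift c (sample ω N v t η) 0 0 with hw
  set G : ℝ → (ZMod N × ZMod N) → ℝ → ℝ → ℝ := fun t η m n =>
    fderiv ℝ v (corner ω N t η + h • (m, n)) ω with hG
  have hwc : ∀ t η ξ, w t η ξ
      = Pih N (fun r => v (r - t • ω)) η ξ + corrector c (sample ω N v t η) 0 0 ξ := by
    intro t η ξ
    rw [Pih_apply_eq_sample]
    simp only [hw, lift, zero_add]
  have hcb : ∀ t η ξ, |corrector c (sample ω N v t η) 0 0 ξ| ≤ (K + 1) * h ^ 2 := by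
    intro t η ξ
    refine (hcorr h hhpos.le (corner ω N t η) ξ).trans ?_
    gcongr
    linarith
  have hstab := meshNorm_le_of_scheme hx.le hy.le (e := fun t => u t - w t)
    (R := fun t η => -lift c (G t η) 0 0 + (N : ℝ) • stencil ω (lift c (sample ω N v t η)))
    (δ := (K + 1) * h ^ 2) (ρ := (T + 1) * h ^ 2) ?_ (by positivity) (by positivity) ?_ ?_ ht
  · have hsplit : u t - Pih N (fun r => v (r - t • ω))
        = (u t - w t) + fun η => corrector c (sample ω N v t η) 0 0 := by
      funext η ξ
      simp only [Pi.add_apply, Pi.sub_apply, hwc]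
      ring
    rw [hsplit]
    refine (meshNorm_add_le (u t - w t) (δ := (K + 1) * h ^ 2) (by positivity)
      (hcb t)).trans ?_
    refine (add_le_add_left (mul_le_mul_of_nonneg_left hstab zero_le_two) _).trans_eq ?_
    ring
  · intro η t
    have hd : HasDerivAt (fun s => w s η) (lift c (fun m n => -G t η m n) 0 0) t :=
      hasDerivAt_lift c (fun m n => hasDerivAt_sample hv t η m n) 0 0
    refine ((hu η t).sub hd).congr_deriv ?_
    have hneg : lift c (fun m n => -G t η m n) 0 0 = -lift c (G t η) 0 0 := by
      funext ξ
      have := lift_const_mul c (-1) (G t η) 0 0 ξ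
      simpa using this
    rw [hneg, ← stencil_sample hp c t η]
    simp only [Pi.sub_apply, Matrix.mulVec_sub, hw]
    module
  · intro η ξ
    simp only [Pi.sub_apply, hwc, hu0, zero_smul, sub_zero]
    have := hcb 0 η ξ
    rwa [sub_add_cancel_left, abs_neg]
  · intro t η ξ
    have := htrunc h hhpos.le (corner ω N t η) ξ
    have hmul : (-lift c (G t η) 0 0 + (N : ℝ) • stencil ω (lift c (sample ω N v t η))) ξ
        = N * (stencil ω (lift c (sample ω N v t η)) ξ - h * lift c (G t η) 0 0 ξ) := by
      simp only [Pi.add_apply, Pi.neg_apply, Pi.smul_apply, smul_eq_mul]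
      linear_combination lift c (G t η) 0 0 ξ * hNh
    rw [hmul, abs_mul, abs_of_pos hN]
    calc _ ≤ N * (T * h ^ 3) := mul_le_mul_of_nonneg_left this hN.le
      _ = T * h ^ 2 := by linear_combination T * h ^ 2 * hNh
      _ ≤ _ := by gcongr; linarith


section ThirdOrder

variable {N : ℕ} [NeZero N]

/-- The spatial operator of the scheme. -/
def schemeMap (ω : ℝ × ℝ) (N : ℕ) [NeZero N] : Mesh N →ₗ[ℝ] Mesh N where
  toFun u η := L00 ω *ᵥ u η + Lm0 ω *ᵥ u (η + (-1, 0)) + L0m ω *ᵥ u (η + (0, -1))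
  map_add' u w := by
    funext η
    simp only [Pi.add_apply, Matrix.mulVec_add]
    abel
  map_smul' k u := by
    funext η
    simp only [Pi.smul_apply, Matrix.mulVec_smul, RingHom.id_apply, smul_add]

lemma exists_isSol (ω : ℝ × ℝ) (u₀ : Mesh N) : ∃ u, IsSol ω N u ∧ u 0 = u₀ := by
  let A : Mesh N →L[ℝ] Mesh N := LinearMap.toContinuousLinearMap (-((N : ℝ) • schemeMap ω N))
  refine ⟨fun t => NormedSpace.exp (t • A) u₀, fun η t => ?_, by simp⟩
  have h := (hasDerivAt_exp_smul_const' (𝕂 := ℝ) A t).clm_apply (hasDerivAt_const t u₀)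
  exact (hasDerivAt_pi.1 h η).congr_deriv (by simp [A, schemeMap])

lemma schemeMap_apply_zero (ω : ℝ × ℝ) (u : Mesh N) (η : ZMod N × ZMod N) :
    schemeMap ω N u η 0 = (ω.1 + ω.2) * (3 * u η 0 + u η 1 + u η 2)
      - ω.1 * (u (η + (-1, 0)) 4 + 4 * u (η + (-1, 0)) 5)
      - ω.2 * (4 * u (η + (0, -1)) 3 + u (η + (0, -1)) 4) := by
  simp [schemeMap, L00, Lm0, L0m, Lx00, Lxm, Ly00, Lym, dotProduct,
    Fin.sum_univ_succ]
  ring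

lemma abs_sum_mul_le_meshNorm {φ : ZMod N × ZMod N → ℝ} (hφ : ∀ η, |φ η| ≤ 1) (u : Mesh N)
    (ζ : ZMod N × ZMod N) (ξ : Fin 6) :
    |∑ η, ((1 : ℝ) / N) ^ 2 * (φ η * u (η + ζ) ξ)| ≤ meshNorm N u := by
  refine Real.le_sqrt_of_sq_le ?_
  rw [sq_abs]
  set h : ℝ := 1 / N
  have h1 := Finset.sum_mul_sq_le_sq_mul_sq Finset.univ (fun η : ZMod N × ZMod N => h * φ η)
    (fun η => h * u (η + ζ) ξ)
  have h2 : ∑ η : ZMod N × ZMod N, (h * φ η) ^ 2 ≤ 1 := by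
    refine le_of_le_of_eq (Finset.sum_le_sum fun η _ => ?_) (sum_const_mesh (N := N) 1)
    rw [mul_pow]
    exact mul_le_mul_of_nonneg_left ((sq_le_one_iff_abs_le_one _).2 (hφ η)) (sq_nonneg h)
  have h3 : ∑ η, (h * u (η + ζ) ξ) ^ 2 ≤ ∑ η, h ^ 2 * ∑ ξ, u η ξ ^ 2 := by
    rw [sum_mesh_shift (fun η => (h * u η ξ) ^ 2) ζ]
    refine Finset.sum_le_sum fun η _ => ?_
    rw [mul_pow]
    exact mul_le_mul_of_nonneg_left
      (Finset.single_le_sum (f := fun ξ => u η ξ ^ 2) (fun _ _ => sq_nonneg _)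
        (Finset.mem_univ ξ)) (sq_nonneg h)
  calc _ = (∑ η, h * φ η * (h * u (η + ζ) ξ)) ^ 2 := by
        congr 1
        exact Finset.sum_congr rfl fun η _ => by ring
    _ ≤ _ := h1
    _ ≤ 1 * ∑ η, h ^ 2 * ∑ ξ, u η ξ ^ 2 := by gcongr
    _ = _ := one_mul _

lemma abs_sum_mul_schemeMap_le {ω : ℝ × ℝ} (hx : 0 ≤ ω.1) (hy : 0 ≤ ω.2)
    {φ : ZMod N × ZMod N → ℝ} (hφ : ∀ η, |φ η| ≤ 1) (u : Mesh N) :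
    |∑ η, ((1 : ℝ) / N) ^ 2 * (φ η * schemeMap ω N u η 0)|
      ≤ 10 * (ω.1 + ω.2) * meshNorm N u := by
  have h := fun ζ ξ => abs_le.1 (abs_sum_mul_le_meshNorm hφ u ζ ξ)
  set S : ZMod N × ZMod N → Fin 6 → ℝ := fun ζ ξ =>
    ∑ η, ((1 : ℝ) / N) ^ 2 * (φ η * u (η + ζ) ξ) with hS
  have hsum : ∑ η, ((1 : ℝ) / N) ^ 2 * (φ η * schemeMap ω N u η 0)
      = (ω.1 + ω.2) * (3 * S 0 0 + S 0 1 + S 0 2) - ω.1 * (S (-1, 0) 4 + 4 * S (-1, 0) 5)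
        - ω.2 * (4 * S (0, -1) 3 + S (0, -1) 4) := by
    simp only [hS, Finset.mul_sum, ← Finset.sum_add_distrib, ← Finset.sum_sub_distrib]
    refine Finset.sum_congr rfl fun η _ => ?_
    rw [schemeMap_apply_zero, add_zero]
    ring
  have hxy : 0 ≤ ω.1 + ω.2 := add_nonneg hx hy
  have a1 : |3 * S 0 0 + S 0 1 + S 0 2| ≤ 5 * meshNorm N u := by
    rw [abs_le]
    constructor <;> linarith [h 0 0, h 0 1, h 0 2]
  have a2 : |S (-1, 0) 4 + 4 * S (-1, 0) 5| ≤ 5 * meshNorm N u := by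
    rw [abs_le]
    constructor <;> linarith [h (-1, 0) 4, h (-1, 0) 5]
  have a3 : |4 * S (0, -1) 3 + S (0, -1) 4| ≤ 5 * meshNorm N u := by
    rw [abs_le]
    constructor <;> linarith [h (0, -1) 3, h (0, -1) 4]
  rw [hsum]
  refine (abs_sub _ _).trans ((add_le_add_left (abs_sub _ _) _).trans ?_)
  rw [abs_mul, abs_mul, abs_mul, abs_of_nonneg hxy, abs_of_nonneg hx, abs_of_nonneg hy]
  nlinarith [mul_le_mul_of_nonneg_left a1 hxy, mul_le_mul_of_nonneg_left a2 hx,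
    mul_le_mul_of_nonneg_left a3 hy]

/-- The error of a plane wave in the first component of each block. -/
lemma hasDerivAt_error_zero {ω : ℝ × ℝ} {u : ℝ → Mesh N} (hu : IsSol ω N u) {f f' : ℝ → ℝ}
    (hf : ∀ x, HasDerivAt f (f' x) x) (hp : ∀ x, f (x + 1) = f x) (η : ZMod N × ZMod N) (t : ℝ) :
    HasDerivAt (fun s => (u s - Pih N (fun r => f (r - s • ω).1)) η 0)
      (-(N * schemeMap ω N (u t - Pih N (fun r => f (r - t • ω).1)) η 0)
        - ω.1 * (N * (f (η.1.val / N - t * ω.1 + 1 / N) - f (η.1.val / N - t * ω.1))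
          - f' (η.1.val / N - t * ω.1))) t := by
  set p : ℝ := η.1.val / N - t * ω.1 with hpdef
  have hper : Periodic2 (fun r => f r.1) := ⟨fun x _ => hp x, fun _ _ => rfl⟩
  have hP : ∀ s η ξ, Pih N (fun r => f (r - s • ω).1) η ξ
      = sample ω N (fun r => f r.1) s η (apt ξ).1 (apt ξ).2 :=
    Pih_apply_eq_sample (v := fun r => f r.1)
  have hs : ∀ m n, sample ω N (fun r => f r.1) t η m n = f (p + 1 / N * m) := fun m n => rfl
  have hscheme : schemeMap ω N (Pih N (fun r => f (r - t • ω).1)) η 0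
      = ω.1 * (f (p + 1 / N) - f p) := by
    rw [schemeMap_apply_zero]
    simp only [hP, sample_shift_left hper, sample_shift_down hper, hs]
    simp [apt]
    ring
  have hd : HasDerivAt (fun s => Pih N (fun r => f (r - s • ω).1) η 0) (f' p * -ω.1) t := by
    have h1 : HasDerivAt (fun s : ℝ => (η.1.val : ℝ) / N - s * ω.1) (-ω.1) t := by
      simpa using ((hasDerivAt_id t).mul_const ω.1).const_sub ((η.1.val : ℝ) / N)
    have h2 := (hf p).comp t h1
    refine h2.congr_of_eventuallyEq (Filter.Eventually.of_forall fun s => ?_)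
    simp [Pih, apt]
  refine ((hasDerivAt_pi.1 (hu η t) 0).sub hd).congr_deriv ?_
  rw [map_sub, Pi.sub_apply, Pi.sub_apply, hscheme]
  simp only [schemeMap, LinearMap.coe_mk, AddHom.coe_mk, Pi.neg_apply, Pi.smul_apply, smul_eq_mul]
  ring

lemma HasOrder.exists_planeWave {ω : ℝ × ℝ} {q : ℕ} (h : HasOrder ω q) {f : ℝ → ℝ}
    (hf : ContDiff ℝ (q + 1 : ℕ) f) (hp : ∀ x, f (x + 1) = f x) :
    ∃ C, 0 ≤ C ∧ ∀ (N : ℕ) [NeZero N], ∃ u : ℝ → Mesh N, IsSol ω N u ∧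
      u 0 = Pih N (fun r => f r.1) ∧ ∀ t, 0 ≤ t → t ≤ 1 →
        meshNorm N (u t - Pih N (fun r => f (r - t • ω).1)) ≤ C * ((1 : ℝ) / N) ^ q := by
  obtain ⟨c1, c2, h1, h2, H⟩ := h (fun r => f r.1) ⟨fun x _ => hp x, fun _ _ => rfl⟩
    (hf.comp contDiff_fst)
  refine ⟨c1 + c2, add_nonneg h1 h2, fun N _ => ?_⟩
  obtain ⟨u, hu, hu0⟩ := exists_isSol ω (Pih N (fun r => f r.1))
  refine ⟨u, hu, hu0, fun t ht ht1 => (H N u hu hu0 t ht).trans ?_⟩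
  gcongr
  nlinarith

end ThirdOrder

open Real in
/-- A lower bound for the phase defect of a forward difference. -/
lemma four_mul_sq_le_phase_defect {h s : ℝ} (hh : 0 ≤ h) (hh2 : 2 * h ≤ 1) (hs0 : 0 ≤ s)
    (hs1 : s ≤ 1) :
    4 * h ^ 2 ≤ cos s * (1 - cos (2 * π * h)) + sin s * (2 * π * h - sin (2 * π * h)) := by
  have hpi := pi_pos
  have hcs : 1 / 2 ≤ cos s := by
    have := one_sub_sq_div_two_le_cos (x := s)
    nlinarith
  have hss : 0 ≤ sin s := sin_nonneg_of_nonneg_of_le_pi hs0 (by linarith [pi_gt_three])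
  have hsinh : sin (2 * π * h) ≤ 2 * π * h := sin_le (by positivity)
  have hcosh : 8 * h ^ 2 ≤ 1 - cos (2 * π * h) := by
    have := cos_le_one_sub_mul_cos_sq (x := 2 * π * h) (by
      rw [abs_of_nonneg (by positivity)]
      nlinarith)
    have e : 2 / π ^ 2 * (2 * π * h) ^ 2 = 8 * h ^ 2 := by field_simp; ring
    linarith
  have := mul_nonneg hss (sub_nonneg.2 hsinh)
  nlinarith [sq_nonneg h]

set_option maxHeartbeats 400000 in
open Real in
lemma not_hasOrder_three {ω : ℝ × ℝ} (hx : 0 < ω.1) (hy : 0 ≤ ω.2) : ¬ HasOrder ω 3 := by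
  intro hord
  have hlin : ∀ x : ℝ, HasDerivAt (fun x => 2 * π * x) (2 * π) x := fun x => by
    simpa using (hasDerivAt_id x).const_mul (2 * π)
  have hc' : ∀ x : ℝ, HasDerivAt (fun x => cos (2 * π * x)) (-sin (2 * π * x) * (2 * π)) x :=
    fun x => (hlin x).cos
  have hs' : ∀ x : ℝ, HasDerivAt (fun x => sin (2 * π * x)) (cos (2 * π * x) * (2 * π)) x :=
    fun x => (hlin x).sin
  have hcp : ∀ x : ℝ, cos (2 * π * (x + 1)) = cos (2 * π * x) := fun x => by
    rw [mul_add, mul_one, cos_add_two_pi]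
  have hsp : ∀ x : ℝ, sin (2 * π * (x + 1)) = sin (2 * π * x) := fun x => by
    rw [mul_add, mul_one, sin_add_two_pi]
  obtain ⟨Cc, hCc, Hc⟩ := hord.exists_planeWave (f := fun x => cos (2 * π * x))
    (contDiff_cos.comp (contDiff_const.mul contDiff_id)) hcp
  obtain ⟨Cs, hCs, Hs⟩ := hord.exists_planeWave (f := fun x => sin (2 * π * x))
    (contDiff_sin.comp (contDiff_const.mul contDiff_id)) hsp
  set M : ℝ := 1 + 10 * (ω.1 + ω.2) with hM
  obtain ⟨N, hN⟩ := exists_nat_gt (max (2 * π * ω.1 + 2) ((Cc + Cs) * M / (4 * ω.1)))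
  obtain ⟨hN1, hN2⟩ := max_lt_iff.1 hN
  have hpi := pi_pos
  have hNpos : (0 : ℝ) < N := by
    refine lt_trans ?_ hN1
    positivity
  have : NeZero N := ⟨by rintro rfl; simp at hNpos⟩
  set h : ℝ := 1 / N with hh
  have hhpos : 0 < h := by positivity
  have hNh : N * h = 1 := by rw [hh]; field_simp
  obtain ⟨uc, huc, huc0, Hc⟩ := Hc N
  obtain ⟨us, hus, hus0, Hs⟩ := Hs N
  set ec : ℝ → Mesh N := fun t => uc t - Pih N (fun r => cos (2 * π * (r - t • ω).1)) with hec
  set es : ℝ → Mesh N := fun t => us t - Pih N (fun r => sin (2 * π * (r - t • ω).1)) with hes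
  set θ : ZMod N × ZMod N → ℝ := fun η => 2 * π * (η.1.val / N) with hθ
  set F : ℝ → ℝ := fun t =>
    ∑ η, h ^ 2 * (cos (θ η) * ec t η 0) + ∑ η, h ^ 2 * (sin (θ η) * es t η 0) with hF
  set P : ℝ → ℝ := fun t => ∑ η, h ^ 2 * (cos (θ η) * schemeMap ω N (ec t) η 0)
    + ∑ η, h ^ 2 * (sin (θ η) * schemeMap ω N (es t) η 0) with hP
  set S : ℝ → ℝ := fun t => ω.1 * (N * (cos (2 * π * (t * ω.1) - 2 * π * h)
    - cos (2 * π * (t * ω.1))) - 2 * π * sin (2 * π * (t * ω.1))) with hS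
  have hFd : ∀ t, HasDerivAt F (-(N * P t) - S t) t := by
    intro t
    have dc := HasDerivAt.fun_sum (u := Finset.univ) fun η (_ : η ∈ Finset.univ) =>
      ((hasDerivAt_error_zero huc hc' hcp η t).const_mul (cos (θ η))).const_mul (h ^ 2)
    have ds := HasDerivAt.fun_sum (u := Finset.univ) fun η (_ : η ∈ Finset.univ) =>
      ((hasDerivAt_error_zero hus hs' hsp η t).const_mul (sin (θ η))).const_mul (h ^ 2)
    refine (dc.add ds).congr_deriv ?_
    rw [← sum_const_mesh (N := N) (S t)]
    simp only [hP, ← Finset.sum_add_distrib, Finset.mul_sum, ← Finset.sum_neg_distrib,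
      ← Finset.sum_sub_distrib]
    refine Finset.sum_congr rfl fun η _ => ?_
    have e1 : 2 * π * ((η.1.val : ℝ) / N - t * ω.1 + 1 / N)
        = θ η - (2 * π * (t * ω.1) - 2 * π * h) := by simp only [hθ, hh]; ring
    have e2 : 2 * π * ((η.1.val : ℝ) / N - t * ω.1) = θ η - 2 * π * (t * ω.1) := by
      simp only [hθ]; ring
    rw [e1, e2]
    simp only [hS]
    generalize 2 * π * (t * ω.1) - 2 * π * h = b
    simp only [cos_sub, sin_sub]
    linear_combination (-h ^ 2 * ω.1 * (N * (cos b - cos (2 * π * (t * ω.1)))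
      - 2 * π * sin (2 * π * (t * ω.1)))) * sin_sq_add_cos_sq (θ η)
  have hF0 : F 0 = 0 := by
    simp [hF, hec, hes, huc0, hus0]
  have hcos : ∀ η, |cos (θ η)| ≤ 1 := fun η => abs_cos_le_one _
  have hsin : ∀ η, |sin (θ η)| ≤ 1 := fun η => abs_sin_le_one _
  have hh1 : h * (2 * π * ω.1 + 2) ≤ 1 := by nlinarith
  have hhle : h ≤ 1 := by nlinarith [mul_pos hpi hx]
  have hFh : |F h| ≤ (Cc + Cs) * h ^ 3 := by
    have a := (abs_sum_mul_le_meshNorm hcos (ec h) 0 0).trans (Hc h hhpos.le hhle)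
    have b := (abs_sum_mul_le_meshNorm hsin (es h) 0 0).trans (Hs h hhpos.le hhle)
    simp only [add_zero, ← hh] at a b
    refine (abs_add_le _ _).trans ?_
    linarith
  obtain ⟨t, ⟨ht0, hth⟩, ht⟩ := exists_hasDerivAt_eq_slope F (fun t => -(N * P t) - S t) hhpos
    (fun t _ => (hFd t).continuousAt.continuousWithinAt) (fun t _ => hFd t)
  have ht1 : t ≤ 1 := hth.le.trans hhle
  have hPt : |P t| ≤ 10 * (ω.1 + ω.2) * ((Cc + Cs) * h ^ 3) := by
    have a := abs_sum_mul_schemeMap_le hx.le hy hcos (ec t)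
    have b := abs_sum_mul_schemeMap_le hx.le hy hsin (es t)
    have k : 0 ≤ 10 * (ω.1 + ω.2) := by positivity
    have a' := mul_le_mul_of_nonneg_left (Hc t ht0.le ht1) k
    have b' := mul_le_mul_of_nonneg_left (Hs t ht0.le ht1) k
    simp only [← hh] at a b a' b'
    refine (abs_add_le _ _).trans ?_
    linarith
  rw [hF0, sub_zero, sub_zero, eq_div_iff hhpos.ne'] at ht
  have hSt : -(h * S t) ≤ (Cc + Cs) * M * h ^ 3 := by
    have e : -(h * S t) = F h + P t := by linear_combination ht + P t * hNh
    rw [e, hM]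
    linarith [le_abs_self (F h), le_abs_self (P t)]
  set s : ℝ := 2 * π * (t * ω.1) with hs
  have hs0 : 0 ≤ s := by positivity
  have hs1 : s ≤ 1 := by
    have : t * (2 * π * ω.1) ≤ h * (2 * π * ω.1) := by gcongr
    rw [hs]
    linarith
  have hlow : ω.1 * (4 * h ^ 2) ≤ -(h * S t) := by
    have e : -(h * S t) = ω.1 * (cos s * (1 - cos (2 * π * h))
        + sin s * (2 * π * h - sin (2 * π * h))) := by
      simp only [hS, ← hs, cos_sub]
      linear_combination (-ω.1 * (cos s * cos (2 * π * h) + sin s * sin (2 * π * h) - cos s)) * hNh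
    rw [e]
    refine mul_le_mul_of_nonneg_left (four_mul_sq_le_phase_defect hhpos.le ?_ hs0 hs1) hx.le
    nlinarith [mul_pos hpi hx]
  have hfin : ω.1 * 4 ≤ (Cc + Cs) * M * h := by
    have h2 : 0 < h ^ 2 := by positivity
    refine le_of_mul_le_mul_right ?_ h2
    linarith
  rw [div_lt_iff₀ (by positivity)] at hN2
  nlinarith [mul_lt_mul_of_pos_right hN2 hhpos]

/-- For `ω_x, ω_y > 0` the optimal order of accuracy of the SD-RT(1)
scheme on the right-triangular mesh is 2: it has order 2 but not order 3. -/
theorem sdrt1_optimal_order_two_of_generic_velocity (ω : ℝ × ℝ)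
    (hx : 0 < ω.1) (hy : 0 < ω.2) :
    HasOrder ω 2 ∧ ¬ HasOrder ω 3 := by
  exact ⟨hasOrder_two hx hy, not_hasOrder_three hx hy.le⟩

end
end

section
/- For every transport velocity ω = (ω_x, ω_y) with ω_x, ω_y ≥ 0 and every φ ∈ ℝ², every eigenvalue λ ∈ ℂ of the complex 6×6 matrix L(φ) satisfies Re λ ≥ 0. -/
open Matrix

noncomputable section

/-- The complex amplification matrix `L(φ) = L_{(0,0)} + e^{-iφx} L_{(-1,0)} + e^{-iφy} L_{(0,-1)}`. -/
def Lphi (ω : ℝ × ℝ) (φ : ℝ × ℝ) : Matrix (Fin 6) (Fin 6) ℂ :=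
  (L00 ω).map (Complex.ofReal)
    + Complex.exp (-Complex.I * φ.1) • (Lm0 ω).map (Complex.ofReal)
    + Complex.exp (-Complex.I * φ.2) • (L0m ω).map (Complex.ofReal)

/-- The squared `L²` norm on an edge, up to a constant factor, of the affine function with end
values `p` and `q`. -/
def edgeEnergy (p q : ℂ) : ℝ :=
  p.re ^ 2 + p.re * q.re + q.re ^ 2 + (p.im ^ 2 + p.im * q.im + q.im ^ 2)

lemma edgeEnergy_nonneg (p q : ℂ) : 0 ≤ edgeEnergy p q := by
  unfold edgeEnergy
  nlinarith [sq_nonneg (p.re + q.re), sq_nonneg (p.im + q.im), sq_nonneg p.re, sq_nonneg q.re,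
    sq_nonneg p.im, sq_nonneg q.im]

/-- The energy on a triangle of the affine function with vertex values `a`, `b`, `c`, in the
Sobolev-type norm that weights the mean-free part by `4 / 3` (up to a constant factor). -/
def cellEnergy (a b c : ℂ) : ℝ :=
  3 * (Complex.normSq a + Complex.normSq b + Complex.normSq c) + 2 * Complex.normSq (a + b + c)

lemma cellEnergy_nonneg (a b c : ℂ) : 0 ≤ cellEnergy a b c := by
  have := Complex.normSq_nonneg a
  have := Complex.normSq_nonneg b
  have := Complex.normSq_nonneg c
  have := Complex.normSq_nonneg (a + b + c)
  unfold cellEnergy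
  linarith

lemma cellEnergy_eq_zero {a b c : ℂ} (h : cellEnergy a b c = 0) : a = 0 ∧ b = 0 ∧ c = 0 := by
  have ha := Complex.normSq_nonneg a
  have hb := Complex.normSq_nonneg b
  have hc := Complex.normSq_nonneg c
  have := Complex.normSq_nonneg (a + b + c)
  unfold cellEnergy at h
  refine ⟨?_, ?_, ?_⟩ <;> rw [← Complex.normSq_eq_zero] <;> linarith

lemma totalEnergy_pos {v : Fin 6 → ℂ} (hv : v ≠ 0) :
    0 < cellEnergy (v 0) (v 1) (v 2) + cellEnergy (v 3) (v 4) (v 5) := by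
  have h₁ := cellEnergy_nonneg (v 0) (v 1) (v 2)
  have h₂ := cellEnergy_nonneg (v 3) (v 4) (v 5)
  refine lt_of_le_of_ne (add_nonneg h₁ h₂) fun h => hv ?_
  obtain ⟨h0, h1, h2⟩ := cellEnergy_eq_zero (a := v 0) (b := v 1) (c := v 2) (by linarith)
  obtain ⟨h3, h4, h5⟩ := cellEnergy_eq_zero (a := v 3) (b := v 4) (c := v 5) (by linarith)
  ext i
  fin_cases i <;> assumption

lemma normSq_exp_neg_I_mul (t : ℝ) :
    (Complex.exp (-Complex.I * t)).re ^ 2 + (Complex.exp (-Complex.I * t)).im ^ 2 = 1 := by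
  have h : ‖Complex.exp (-Complex.I * t)‖ = 1 := by
    rw [Complex.norm_exp]
    simp
  have h' := Complex.normSq_eq_norm_sq (Complex.exp (-Complex.I * t))
  rw [h, Complex.normSq_apply] at h'
  linarith

/-- Energy balance: only the jumps across the edges dissipate energy. -/
lemma re_mul_totalEnergy (ω φ : ℝ × ℝ) (lam : ℂ) (v : Fin 6 → ℂ)
    (heig : Lphi ω φ *ᵥ v = lam • v) :
    lam.re * (cellEnergy (v 0) (v 1) (v 2) + cellEnergy (v 3) (v 4) (v 5)) =
      9 * (ω.1 * edgeEnergy (v 0 - Complex.exp (-Complex.I * φ.1) * v 5)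
            (v 2 - Complex.exp (-Complex.I * φ.1) * v 4)
        + ω.2 * edgeEnergy (v 0 - Complex.exp (-Complex.I * φ.2) * v 3)
            (v 1 - Complex.exp (-Complex.I * φ.2) * v 4)
        + (ω.1 + ω.2) * edgeEnergy (v 3 - v 2) (v 5 - v 1)) := by
  have hw := normSq_exp_neg_I_mul φ.1
  have hz := normSq_exp_neg_I_mul φ.2
  have h := fun i => congrFun heig i
  unfold Lphi at h
  generalize Complex.exp (-Complex.I * φ.1) = w at h hw ⊢
  generalize Complex.exp (-Complex.I * φ.2) = z at h hz ⊢
  have hre := fun i => congrArg Complex.re (h i)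
  have him := fun i => congrArg Complex.im (h i)
  simp only [Fin.forall_fin_succ] at hre him
  simp [L00, Lm0, L0m, Lx00, Lxm, Ly00, Lym, Matrix.mulVec, dotProduct, Fin.sum_univ_succ]
    at hre him
  obtain ⟨r0, r1, r2, r3, r4, r5⟩ := hre
  obtain ⟨i0, i1, i2, i3, i4, i5⟩ := him
  simp only [cellEnergy, edgeEnergy, Complex.normSq_apply, Complex.add_re, Complex.add_im,
    Complex.sub_re, Complex.sub_im, Complex.mul_re, Complex.mul_im]
  linear_combination
    -(3 * (v 0).re + 2 * ((v 0).re + (v 1).re + (v 2).re)) * r0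
    - (3 * (v 0).im + 2 * ((v 0).im + (v 1).im + (v 2).im)) * i0
    - (3 * (v 1).re + 2 * ((v 0).re + (v 1).re + (v 2).re)) * r1
    - (3 * (v 1).im + 2 * ((v 0).im + (v 1).im + (v 2).im)) * i1
    - (3 * (v 2).re + 2 * ((v 0).re + (v 1).re + (v 2).re)) * r2
    - (3 * (v 2).im + 2 * ((v 0).im + (v 1).im + (v 2).im)) * i2
    - (3 * (v 3).re + 2 * ((v 3).re + (v 4).re + (v 5).re)) * r3
    - (3 * (v 3).im + 2 * ((v 3).im + (v 4).im + (v 5).im)) * i3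
    - (3 * (v 4).re + 2 * ((v 3).re + (v 4).re + (v 5).re)) * r4
    - (3 * (v 4).im + 2 * ((v 3).im + (v 4).im + (v 5).im)) * i4
    - (3 * (v 5).re + 2 * ((v 3).re + (v 4).re + (v 5).re)) * r5
    - (3 * (v 5).im + 2 * ((v 3).im + (v 4).im + (v 5).im)) * i5
    - 9 * ω.1 * ((v 5).re ^ 2 + (v 5).re * (v 4).re + (v 4).re ^ 2
      + ((v 5).im ^ 2 + (v 5).im * (v 4).im + (v 4).im ^ 2)) * hw
    - 9 * ω.2 * ((v 3).re ^ 2 + (v 3).re * (v 4).re + (v 4).re ^ 2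
      + ((v 3).im ^ 2 + (v 3).im * (v 4).im + (v 4).im ^ 2)) * hz

/-- For `ω_x, ω_y ≥ 0` and every `φ ∈ ℝ²`, every eigenvalue `λ` of the
complex matrix `L(φ)` satisfies `Re λ ≥ 0`. -/
theorem sdrt1_eigenvalues_nonneg_real_part (ω : ℝ × ℝ) (hx : 0 ≤ ω.1) (hy : 0 ≤ ω.2)
    (φ : ℝ × ℝ) (lam : ℂ) (v : Fin 6 → ℂ) (hv : v ≠ 0)
    (heig : Lphi ω φ *ᵥ v = lam • v) :
    0 ≤ lam.re := by
  have hE := re_mul_totalEnergy ω φ lam v heig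
  refine nonneg_of_mul_nonneg_left (hE ▸ ?_) (totalEnergy_pos hv)
  have h₁ := fun p q => mul_nonneg hx (edgeEnergy_nonneg p q)
  have h₂ := fun p q => mul_nonneg hy (edgeEnergy_nonneg p q)
  have h₃ := fun p q => mul_nonneg (add_nonneg hx hy) (edgeEnergy_nonneg p q)
  exact mul_nonneg (by norm_num) (add_nonneg (add_nonneg (h₁ _ _) (h₂ _ _)) (h₃ _ _))

end
end

section
/- If ω_x > 0 and ω_y > 0, then the left kernel of L(0), that is, the set {y ∈ ℝ^6 : yᵀ L(0) = 0}, is exactly the one-dimensional span of the vector (1,1,1,1,1,1). -/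
open Matrix

noncomputable section

/-- All columns of `L(0)` sum to zero. -/
theorem one_vecMul_Lzero (ω : ℝ × ℝ) : (fun _ => 1 : Fin 6 → ℝ) ᵥ* Lzero ω = 0 := by
  funext j
  fin_cases j <;>
    simp [vecMul, dotProduct, Fin.sum_univ_succ, Lzero, L00, Lm0, L0m, Lx00, Lxm, Ly00, Lym] <;>
    ring

/-- A vector in the left kernel of `L(0)` is constant. -/
theorem eq_last_of_vecMul_Lzero_eq_zero {a b : ℝ} (ha : 0 < a) (hb : 0 < b) {y : Fin 6 → ℝ}
    (h : y ᵥ* Lzero (a, b) = 0) (i : Fin 6) : y i = y 5 := by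
  have hD : 27 * a * b * (a + b) ≠ 0 := by positivity
  have h0 : a * (3 * y 0 - 3 * y 1) +
      b * (3 * y 0 - 3 * y 2) = 0 := by
    have := congrFun h 0
    simp [vecMul, dotProduct, Fin.sum_univ_succ, Lzero, L00, Lm0, L0m, Lx00, Lxm, Ly00, Lym] at this
    linear_combination this
  have h1 : a * (y 0 + y 1 + y 2 - y 3 + 2 * y 4 - 4 * y 5) +
      b * (y 0 + 4 * y 1 - 2 * y 2 - y 3 + 2 * y 4 - 4 * y 5) = 0 := by
    have := congrFun h 1
    simp [vecMul, dotProduct, Fin.sum_univ_succ, Lzero, L00, Lm0, L0m, Lx00, Lxm, Ly00, Lym] at this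
    linear_combination this
  have h2 : a * (y 0 - 2 * y 1 + 4 * y 2 - 4 * y 3 + 2 * y 4 - y 5) +
      b * (y 0 + y 1 + y 2 - 4 * y 3 + 2 * y 4 - y 5) = 0 := by
    have := congrFun h 2
    simp [vecMul, dotProduct, Fin.sum_univ_succ, Lzero, L00, Lm0, L0m, Lx00, Lxm, Ly00, Lym] at this
    linear_combination this
  have h3 : a * (3 * y 3 - 3 * y 4) +
      b * (-4 * y 0 - y 1 + 2 * y 2 + 4 * y 3 - 2 * y 4 + y 5) = 0 := by
    have := congrFun h 3
    simp [vecMul, dotProduct, Fin.sum_univ_succ, Lzero, L00, Lm0, L0m, Lx00, Lxm, Ly00, Lym] at this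
    linear_combination this
  have h4 : a * (-y 0 + 2 * y 1 - 4 * y 2 + y 3 + y 4 + y 5) +
      b * (-y 0 - 4 * y 1 + 2 * y 2 + y 3 + y 4 + y 5) = 0 := by
    have := congrFun h 4
    simp [vecMul, dotProduct, Fin.sum_univ_succ, Lzero, L00, Lm0, L0m, Lx00, Lxm, Ly00, Lym] at this
    linear_combination this
  have e0 : y 0 = y 5 := by
    apply mul_left_cancel₀ hD
    linear_combination (4 * a * b + 5 * b ^ 2) * h0 +
      (6 * a * b) * h1 +
      (-2 * a ^ 2 + 5 * b ^ 2) * h2 +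
      (-2 * a ^ 2 + 3 * a * b + 5 * b ^ 2) * h3 +
      (-2 * a ^ 2 - a * b) * h4
  have e1 : y 1 = y 5 := by
    apply mul_left_cancel₀ hD
    linear_combination (-5 * a * b + 2 * b ^ 2) * h0 +
      (6 * a * b) * h1 +
      (-2 * a ^ 2 - 3 * a * b + 2 * b ^ 2) * h2 +
      (-2 * a ^ 2 + 2 * b ^ 2) * h3 +
      (-2 * a ^ 2 - 4 * a * b) * h4
  have e2 : y 2 = y 5 := by
    apply mul_left_cancel₀ hD
    linear_combination (-2 * a * b + 5 * b ^ 2) * h0 +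
      (6 * a * b) * h1 +
      (a ^ 2 + 3 * a * b + 5 * b ^ 2) * h2 +
      (a ^ 2 + 6 * a * b + 5 * b ^ 2) * h3 +
      (a ^ 2 - a * b) * h4
  have e3 : y 3 = y 5 := by
    apply mul_left_cancel₀ hD
    linear_combination (3 * a * b + 3 * b ^ 2) * h0 +
      (9 * a * b) * h1 +
      (3 * a ^ 2 - 3 * a * b + 3 * b ^ 2) * h2 +
      (3 * a ^ 2 + 6 * a * b + 3 * b ^ 2) * h3 +
      (3 * a ^ 2 + 3 * a * b) * h4
  have e4 : y 4 = y 5 := by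
    apply mul_left_cancel₀ hD
    linear_combination (3 * a * b) * h0 +
      (9 * a * b) * h1 +
      (3 * a ^ 2 + 3 * a * b) * h2 +
      (3 * a ^ 2 + 3 * a * b) * h3 +
      (3 * a ^ 2 + 9 * a * b) * h4
  fin_cases i
  exacts [e0, e1, e2, e3, e4, rfl]

/-- For `ω_x, ω_y > 0`, the left kernel of `L(0)` is exactly the
one-dimensional span of `(1,1,1,1,1,1)`. -/
theorem sdrt1_left_kernel_generic (ω : ℝ × ℝ) (hx : 0 < ω.1) (hy : 0 < ω.2) :
    {y : Fin 6 → ℝ | y ᵥ* Lzero ω = 0}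
      = ↑(Submodule.span ℝ {(fun _ => 1 : Fin 6 → ℝ)}) := by
  obtain ⟨a, b⟩ := ω
  ext y
  simp only [Set.mem_ofPred_eq, SetLike.mem_coe, Submodule.mem_span_singleton]
  constructor
  · exact fun h => ⟨y 5, funext fun i => by
      simpa using (eq_last_of_vecMul_Lzero_eq_zero hx hy h i).symm⟩
  · rintro ⟨c, rfl⟩
    rw [smul_vecMul, one_vecMul_Lzero, smul_zero]

end
end

section
/- If ω_x > 0 and ω_y = 0, then the left kernel of L(0), that is, the set {y ∈ ℝ^6 : yᵀ L(0) = 0}, is exactly the two-dimensional span of the vectors (1,1,1,1,1,1) and (5,5,2,0,0,3). -/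
open Matrix

noncomputable section

/-- For `ω_x > 0` and `ω_y = 0`, the left kernel of `L(0)` is exactly the
two-dimensional span of `(1,1,1,1,1,1)` and `(5,5,2,0,0,3)`. -/
theorem sdrt1_left_kernel_edge_parallel (ω : ℝ × ℝ) (hx : 0 < ω.1) (hy : ω.2 = 0) :
    {y : Fin 6 → ℝ | y ᵥ* Lzero ω = 0}
      = ↑(Submodule.span ℝ {(fun _ => 1 : Fin 6 → ℝ), ![5, 5, 2, 0, 0, 3]}) := by
  ext y
  simp only [Set.mem_ofPred_eq, SetLike.mem_coe, Submodule.mem_span_pair]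
  constructor
  · intro h
    have hcol (j : Fin 6) : (y ᵥ* (Lx00 + Lxm)) j = 0 := by
      have hj := congrFun h j
      rw [Lzero, L00, Lm0, L0m, hy, zero_smul, zero_smul, add_zero, add_zero, ← smul_add,
        vecMul_smul, Pi.smul_apply, smul_eq_mul, Pi.zero_apply] at hj
      exact (mul_eq_zero.mp hj).resolve_left hx.ne'
    have h0 := hcol 0
    have h1 := hcol 1
    have h2 := hcol 2
    have h3 := hcol 3
    simp [vecMul, dotProduct, Fin.sum_univ_succ, Lx00, Lxm] at h0 h1 h2 h3
    refine ⟨y 3, (y 0 - y 3) / 5, ?_⟩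
    ext j
    fin_cases j <;> simp <;> linarith
  · rintro ⟨a, b, rfl⟩
    ext j
    fin_cases j <;>
      simp [vecMul, dotProduct, Fin.sum_univ_succ, Lzero, L00, Lm0, L0m, Lx00, Lxm, hy] <;>
      ring

end
end

section
/- For every transport velocity ω = (ω_x, ω_y) with ω_x, ω_y ≥ 0 and every multiindex m = (m_x, m_y) with m_x + m_y = 2, the truncation-error vector f^m ∈ ℝ^6 is orthogonal to (1,1,1,1,1,1), i.e., Σ_{ξ=1}^{6} f^m_ξ = 0. Equivalently, the integral over the periodic cell (0,1)² of the piecewise-linear function taking the values f^m_1, f^m_2, f^m_3 at the vertices (0,0), (1,0), (0,1) of the lower-left triangle and the values f^m_4, f^m_5, f^m_6 at the vertices (0,1), (1,1), (1,0) of the upper-right triangle vanishes. -/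
open Matrix

noncomputable section

/-- `q_m(x,y) = x^{m_x} y^{m_y} / (m_x! · m_y!)`. -/
def qm (m : ℕ × ℕ) (r : ℝ × ℝ) : ℝ :=
  r.1 ^ m.1 * r.2 ^ m.2 / ((m.1.factorial : ℝ) * (m.2.factorial : ℝ))

/-- The truncation-error vector
`f^m_ξ = -(ω·∇)q_m(a_ξ) + Σ_{ζ∈S} Σ_j (L_ζ)_{ξj} q_m(ζ + a_j)`. -/
def fvec (ω : ℝ × ℝ) (m : ℕ × ℕ) : Fin 6 → ℝ := fun ξ =>
  -(fderiv ℝ (qm m) (apt ξ) ω)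
    + ∑ j : Fin 6, (L00 ω ξ j * qm m (((0 : ℝ), (0 : ℝ)) + apt j)
        + Lm0 ω ξ j * qm m (((-1 : ℝ), (0 : ℝ)) + apt j)
        + L0m ω ξ j * qm m (((0 : ℝ), (-1 : ℝ)) + apt j))

/-- The directional derivative of the monomial `q_m`. -/
theorem fderiv_qm_apply (m : ℕ × ℕ) (r ω : ℝ × ℝ) :
    fderiv ℝ (qm m) r ω =
      (m.1 * r.1 ^ (m.1 - 1) * ω.1 * r.2 ^ m.2 + r.1 ^ m.1 * (m.2 * r.2 ^ (m.2 - 1) * ω.2)) /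
        ((m.1.factorial : ℝ) * (m.2.factorial : ℝ)) := by
  have h := (((hasFDerivAt_fst (𝕜 := ℝ) (p := r)).pow m.1).mul
    ((hasFDerivAt_snd (𝕜 := ℝ) (p := r)).pow m.2)).mul_const
      ((m.1.factorial : ℝ) * (m.2.factorial : ℝ))⁻¹
  have hq : HasFDerivAt (qm m) _ r := h
  rw [hq.fderiv]
  simp [div_eq_mul_inv]
  ring

/-- For `ω_x, ω_y ≥ 0` and every multiindex `m` with `|m| = 2`, the
truncation-error vector `f^m` is orthogonal to `(1,1,1,1,1,1)`: `Σ_ξ f^m_ξ = 0`. -/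
theorem sdrt1_mean_truncation_error_zero (ω : ℝ × ℝ) (hx : 0 ≤ ω.1) (hy : 0 ≤ ω.2)
    (m : ℕ × ℕ) (hm : m.1 + m.2 = 2) :
    ∑ ξ : Fin 6, fvec ω m ξ = 0 := by
  obtain ⟨a, b⟩ := m
  obtain ⟨rfl, rfl⟩ | ⟨rfl, rfl⟩ | ⟨rfl, rfl⟩ :
      (a = 0 ∧ b = 2) ∨ (a = 1 ∧ b = 1) ∨ (a = 2 ∧ b = 0) := by
    simp only at hm
    omega
  all_goals
    simp [fvec, fderiv_qm_apply, Fin.sum_univ_six, qm, apt, L00, Lm0, L0m, Lx00, Lxm, Ly00, Lym] <;>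
    ring

end
end

section
/- If ω_x > 0 and ω_y = 0, then the truncation-error vector f^{(2,0)} does not belong to the range (column space) of the matrix L(0), i.e., there is no x ∈ ℝ^6 with L(0)·x = f^{(2,0)}. -/
open Matrix

noncomputable section

theorem fderiv_qm_two_zero (r ω : ℝ × ℝ) : fderiv ℝ (qm (2, 0)) r ω = r.1 * ω.1 := by
  have hq : qm (2, 0) = fun r : ℝ × ℝ => r.1 ^ 2 * (1 / 2 : ℝ) := by
    funext r
    simp [qm, div_eq_mul_inv]
  have hd : HasFDerivAt (fun r : ℝ × ℝ => r.1 ^ 2 * (1 / 2 : ℝ)) _ r :=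
    ((hasFDerivAt_fst (𝕜 := ℝ) (p := r)).pow 2).mul_const (1 / 2 : ℝ)
  rw [hq, hd.fderiv]
  simp
  ring

/-- The vector `(0, 0, 3, 5, 5, 2)` lies in the left kernel of `L(0)` when `ω_y = 0`. -/
theorem vecMul_Lzero_eq_zero (ω : ℝ × ℝ) (hy : ω.2 = 0) :
    ![0, 0, 3, 5, 5, 2] ᵥ* Lzero ω = 0 := by
  ext j
  fin_cases j <;>
    simp [Lzero, L00, Lm0, L0m, Lx00, Lxm, hy, vecMul, dotProduct, Fin.sum_univ_succ] <;> ring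

theorem dotProduct_fvec_two_zero (ω : ℝ × ℝ) (hy : ω.2 = 0) :
    ![0, 0, 3, 5, 5, 2] ⬝ᵥ fvec ω (2, 0) = ω.1 / 2 := by
  simp [fvec, fderiv_qm_two_zero, qm, apt, L00, Lm0, L0m, Lx00, Lxm, hy, dotProduct,
    Fin.sum_univ_succ]
  ring

/-- If `ω_x > 0` and `ω_y = 0`, then `f^{(2,0)}` is not in the range
(column space) of `L(0)`. -/
theorem sdrt1_truncation_error_not_in_range (ω : ℝ × ℝ) (hx : 0 < ω.1) (hy : ω.2 = 0) :
    ¬ ∃ x : Fin 6 → ℝ, Lzero ω *ᵥ x = fvec ω (2, 0) := by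
  rintro ⟨x, hx'⟩
  have h := dotProduct_fvec_two_zero ω hy
  rw [← hx', dotProduct_mulVec, vecMul_Lzero_eq_zero ω hy, zero_dotProduct] at h
  linarith

end
end

section
/- Let ω_x > 0 and ω_y = 0. For h > 0, define the modified mapping Π̃_h taking each v ∈ C²(ℝ²) to the family of values (Π̃_h v)_{η,ξ} = v(r_{η,ξ}) + h·c_ξ·((1/2)·∂_x v − ∂_y v)(r_{η,ξ}) − (h²/6)·d_ξ·∂²_x v(r_{η,ξ}), where η ∈ ℤ², ξ = 1,…,6, r_{η,ξ} = (η + a_ξ)h, c = (0,0,1,1,1,0) and d = (1,0,0,1,0,0). Then the SD-RT(1) scheme is 2-exact in the sense of Π̃_h: for every polynomial f of two variables of degree at most 2, the function u(t) = Π̃_h applied to r ↦ f(r − ωt) satisfies du_η/dt + (1/h)·Σ_{ζ∈S} L_ζ u_{η+ζ}(t) = 0 for all η ∈ ℤ² and all t ∈ ℝ. -/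
open Matrix

noncomputable section

/-- The coefficients `c_ξ`. -/
def cvec : Fin 6 → ℝ := ![0, 0, 1, 1, 1, 0]

/-- The coefficients `d_ξ`. -/
def dvec : Fin 6 → ℝ := ![1, 0, 0, 1, 0, 0]

/-- The modified mapping `Π̃_h` on the infinite mesh:
`(Π̃_h v)_{η,ξ} = v(r) + h c_ξ ((1/2)∂ₓv - ∂_y v)(r) - (h²/6) d_ξ ∂ₓ²v(r)`,
where `r = (η + a_ξ)h`. -/
def Pitilde (h : ℝ) (v : ℝ × ℝ → ℝ) : ℤ × ℤ → Fin 6 → ℝ := fun η ξ =>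
  let r : ℝ × ℝ := (((η.1 : ℝ) + (apt ξ).1) * h, ((η.2 : ℝ) + (apt ξ).2) * h)
  v r + h * cvec ξ * ((1 / 2) * fderiv ℝ v r (1, 0) - fderiv ℝ v r (0, 1))
    - h ^ 2 / 6 * dvec ξ * fderiv ℝ (fun p => fderiv ℝ v p (1, 0)) r (1, 0)

/-- Directional derivative of a translated bivariate polynomial of degree at most two. -/
theorem fderiv_quadratic_sub_apply (c00 c10 c01 c20 c11 c02 : ℝ) (a p v : ℝ × ℝ) :
    fderiv ℝ (fun r : ℝ × ℝ => c00 + c10 * (r - a).1 + c01 * (r - a).2 + c20 * (r - a).1 ^ 2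
      + c11 * (r - a).1 * (r - a).2 + c02 * (r - a).2 ^ 2) p v =
    (c10 + 2 * c20 * (p.1 - a.1) + c11 * (p.2 - a.2)) * v.1
      + (c01 + c11 * (p.1 - a.1) + 2 * c02 * (p.2 - a.2)) * v.2 := by
  have h1 : HasFDerivAt (fun r : ℝ × ℝ => (r - a).1) (ContinuousLinearMap.fst ℝ ℝ ℝ) p :=
    hasFDerivAt_fst.sub_const a.1
  have h2 : HasFDerivAt (fun r : ℝ × ℝ => (r - a).2) (ContinuousLinearMap.snd ℝ ℝ ℝ) p :=
    hasFDerivAt_snd.sub_const a.2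
  have H := ((((h1.const_mul c10).const_add c00).add (h2.const_mul c01)).add
    ((h1.pow 2).const_mul c20)).add ((h1.const_mul c11).mul h2) |>.add ((h2.pow 2).const_mul c02)
  have H' := congrArg (fun L : ℝ × ℝ →L[ℝ] ℝ => L v) H.fderiv
  refine Eq.trans H' ?_
  simp
  ring

/-- Directional derivative of an affine function of two variables. -/
theorem fderiv_affine_sub_apply (c00 c10 c01 : ℝ) (a p v : ℝ × ℝ) :
    fderiv ℝ (fun r : ℝ × ℝ => c00 + c10 * (r.1 - a.1) + c01 * (r.2 - a.2)) p v =
    c10 * v.1 + c01 * v.2 := by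
  simpa using fderiv_quadratic_sub_apply c00 c10 c01 0 0 0 a p v

/-- Closed form of the modified mapping on translated polynomials of degree at most two. -/
theorem Pitilde_quadratic_sub (c00 c10 c01 c20 c11 c02 h : ℝ) (a : ℝ × ℝ) (η : ℤ × ℤ)
    (ξ : Fin 6) :
    Pitilde h (fun r : ℝ × ℝ => c00 + c10 * (r - a).1 + c01 * (r - a).2 + c20 * (r - a).1 ^ 2
      + c11 * (r - a).1 * (r - a).2 + c02 * (r - a).2 ^ 2) η ξ =
    c00 + c10 * ((η.1 + (apt ξ).1) * h - a.1) + c01 * ((η.2 + (apt ξ).2) * h - a.2)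
      + c20 * ((η.1 + (apt ξ).1) * h - a.1) ^ 2
      + c11 * ((η.1 + (apt ξ).1) * h - a.1) * ((η.2 + (apt ξ).2) * h - a.2)
      + c02 * ((η.2 + (apt ξ).2) * h - a.2) ^ 2
      + h * cvec ξ * ((1 / 2) * (c10 + 2 * c20 * ((η.1 + (apt ξ).1) * h - a.1)
          + c11 * ((η.2 + (apt ξ).2) * h - a.2))
        - (c01 + c11 * ((η.1 + (apt ξ).1) * h - a.1)
          + 2 * c02 * ((η.2 + (apt ξ).2) * h - a.2)))
      - h ^ 2 / 6 * dvec ξ * (2 * c20) := by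
  simp only [Pitilde, fderiv_quadratic_sub_apply, mul_one, mul_zero, add_zero, zero_add]
  simp only [fderiv_affine_sub_apply, mul_one, mul_zero, add_zero, Prod.fst_sub, Prod.snd_sub]

/-- For `ω_x > 0`, `ω_y = 0`, the SD-RT(1) scheme is 2-exact in the sense
of `Π̃_h`: for every polynomial `f` of degree at most 2, the mesh function
`u(t) = Π̃_h (r ↦ f(r - ωt))` satisfies the semidiscrete scheme on the infinite mesh. -/
theorem sdrt1_two_exactness_modified_mapping (ω : ℝ × ℝ) (hx : 0 < ω.1) (hy : ω.2 = 0)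
    (h : ℝ) (hh : 0 < h) (f : ℝ × ℝ → ℝ)
    (hf : ∃ c00 c10 c01 c20 c11 c02 : ℝ, f = fun p : ℝ × ℝ =>
      c00 + c10 * p.1 + c01 * p.2 + c20 * p.1 ^ 2 + c11 * p.1 * p.2 + c02 * p.2 ^ 2)
    (u : ℝ → ℤ × ℤ → Fin 6 → ℝ)
    (hu : u = fun s => Pitilde h (fun r => f (r - s • ω))) :
    ∀ (η : ℤ × ℤ) (t : ℝ),
      HasDerivAt (fun s => u s η)
        (-((1 / h) • (L00 ω *ᵥ u t η + Lm0 ω *ᵥ u t (η + (-1, 0))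
            + L0m ω *ᵥ u t (η + (0, -1))))) t := by
  obtain ⟨c00, c10, c01, c20, c11, c02, rfl⟩ := hf
  obtain ⟨w, w'⟩ := ω
  obtain rfl : w' = 0 := hy
  subst hu
  rintro ⟨m, n⟩ t
  rw [hasDerivAt_pi]
  intro ξ
  simp only [Pi.neg_apply, Pi.smul_apply, Pi.add_apply, mulVec, dotProduct, Pitilde_quadratic_sub,
    Prod.smul_fst, Prod.smul_snd, smul_eq_mul, mul_zero, sub_zero]
  have hX (x : ℝ) : HasDerivAt (fun s => x - s * w) (-w) t := by
    simpa using ((hasDerivAt_id t).mul_const w).const_sub x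
  generalize hY : ((n : ℝ) + (apt ξ).2) * h = Y
  have H := hX ((m + (apt ξ).1) * h)
  refine HasDerivAt.congr_deriv ((((((((H.const_mul c10).const_add c00).add_const (c01 * Y)).add
    ((H.pow 2).const_mul c20)).add ((H.const_mul c11).mul_const Y)).add_const (c02 * Y ^ 2)).add
    ((((((H.const_mul (2 * c20)).const_add c10).add_const (c11 * Y)).const_mul (1 / 2)).sub
      (((H.const_mul c11).const_add c01).add_const (2 * c02 * Y))).const_mul
        (h * cvec ξ))).sub_const (h ^ 2 / 6 * dvec ξ * (2 * c20))) ?_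
  subst hY
  have hne := hh.ne'
  fin_cases ξ <;>
  · simp [Fin.sum_univ_six, L00, Lm0, L0m, Lx00, Lxm, apt, cvec, dvec]
    field_simp
    ring

end
end
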